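/- arXiv:1106.4972 — 2 statements merged into one kernel-verified Lean document; each statement's English description precedes it below -/
import Mathlib

section
/- Let (R, m, k) be a Noetherian local ring and M a G–Gorenstein R-module of Krull dimension d. If the top local cohomology module H_m^d(M) has finite flat dimension, then R is a Gorenstein ring and M is a Gorenstein module. -/
universe u

namespace GG

open RingTheory.Sequence

variable (R : Type u) [CommRing R]

/-- A module `N` is Gorenstein injective if it is a kernel in a `Hom(Inj,−)`-exact exact
doubly infinite complex of injective modules. -/
def IsGorensteinInjective (N : Type u) [AddCommGroup N] [Module R N] : Prop :=
  ∃ (X : ℤ → ModuleCat.{u} R) (d : ∀ n : ℤ, X n →ₗ[R] X (n + 1)),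
    (∀ n, Module.Injective R (X n)) ∧
    (∀ n, LinearMap.range (d n) = LinearMap.ker (d (n + 1))) ∧
    (∀ (I : ModuleCat.{u} R), Module.Injective R I →
      ∀ (n : ℤ) (φ : I →ₗ[R] X (n + 1)), (d (n + 1)).comp φ = 0 →
        ∃ ψ : I →ₗ[R] X n, (d n).comp ψ = φ) ∧
    Nonempty (N ≃ₗ[R] LinearMap.ker (d 0))

/-- A module `N` is Gorenstein projective if it is a kernel in a `Hom(−,Proj)`-exact exact
doubly infinite complex of projective modules. -/
def IsGorensteinProjective (N : Type u) [AddCommGroup N] [Module R N] : Prop :=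
  ∃ (X : ℤ → ModuleCat.{u} R) (d : ∀ n : ℤ, X n →ₗ[R] X (n + 1)),
    (∀ n, Module.Projective R (X n)) ∧
    (∀ n, LinearMap.range (d n) = LinearMap.ker (d (n + 1))) ∧
    (∀ (P : ModuleCat.{u} R), Module.Projective R P →
      ∀ (n : ℤ) (φ : X (n + 1) →ₗ[R] P), φ.comp (d n) = 0 →
        ∃ ψ : X (n + 1 + 1) →ₗ[R] P, ψ.comp (d (n + 1)) = φ) ∧
    Nonempty (N ≃ₗ[R] LinearMap.ker (d 0))

/-- A module `N` is Gorenstein flat if it is a kernel in an `(Inj ⊗ −)`-exact exact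
doubly infinite complex of flat modules. -/
def IsGorensteinFlat (N : Type u) [AddCommGroup N] [Module R N] : Prop :=
  ∃ (X : ℤ → ModuleCat.{u} R) (d : ∀ n : ℤ, X n →ₗ[R] X (n + 1)),
    (∀ n, Module.Flat R (X n)) ∧
    (∀ n, LinearMap.range (d n) = LinearMap.ker (d (n + 1))) ∧
    (∀ (I : ModuleCat.{u} R), Module.Injective R I →
      ∀ n : ℤ, LinearMap.range (LinearMap.lTensor (R := R) I (d n)) =
        LinearMap.ker (LinearMap.lTensor (R := R) I (d (n + 1)))) ∧
    Nonempty (N ≃ₗ[R] LinearMap.ker (d 0))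

/-- Existence of a right resolution of length `≤ n` by modules satisfying `P`. -/
def CoresolutionLE (P : ModuleCat.{u} R → Prop) (M : Type u) [AddCommGroup M] [Module R M]
    (n : ℕ) : Prop :=
  ∃ (G : ℕ → ModuleCat.{u} R) (d : ∀ i : ℕ, G i →ₗ[R] G (i + 1)) (ε : M →ₗ[R] G 0),
    (∀ i, P (G i)) ∧ Function.Injective ε ∧
    LinearMap.range ε = LinearMap.ker (d 0) ∧
    (∀ i, LinearMap.range (d i) = LinearMap.ker (d (i + 1))) ∧
    (∀ i, n < i → ∀ x : G i, x = 0)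

/-- Existence of a left resolution of length `≤ n` by modules satisfying `P`. -/
def ResolutionLE (P : ModuleCat.{u} R → Prop) (M : Type u) [AddCommGroup M] [Module R M]
    (n : ℕ) : Prop :=
  ∃ (G : ℕ → ModuleCat.{u} R) (d : ∀ i : ℕ, G (i + 1) →ₗ[R] G i) (ε : G 0 →ₗ[R] M),
    (∀ i, P (G i)) ∧ Function.Surjective ε ∧
    LinearMap.ker ε = LinearMap.range (d 0) ∧
    (∀ i, LinearMap.ker (d i) = LinearMap.range (d (i + 1))) ∧
    (∀ i, n < i → ∀ x : G i, x = 0)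

/-- `Gid_R M ≤ n`. -/
def gidLE (M : Type u) [AddCommGroup M] [Module R M] (n : ℕ) : Prop :=
  CoresolutionLE R (fun N => IsGorensteinInjective R N) M n

/-- `id_R M ≤ n`. -/
def idLE (M : Type u) [AddCommGroup M] [Module R M] (n : ℕ) : Prop :=
  CoresolutionLE R (fun N => Module.Injective R N) M n

/-- `pd_R M ≤ n`. -/
def pdLE (M : Type u) [AddCommGroup M] [Module R M] (n : ℕ) : Prop :=
  ResolutionLE R (fun N => Module.Projective R N) M n

/-- `fd_R M ≤ n`. -/
def fdLE (M : Type u) [AddCommGroup M] [Module R M] (n : ℕ) : Prop :=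
  ResolutionLE R (fun N => Module.Flat R N) M n

/-- `Gfd_R M ≤ n`. -/
def gfdLE (M : Type u) [AddCommGroup M] [Module R M] (n : ℕ) : Prop :=
  ResolutionLE R (fun N => IsGorensteinFlat R N) M n

/-- Gorenstein injective dimension, as an extended natural number. -/
noncomputable def gid (M : Type u) [AddCommGroup M] [Module R M] : ℕ∞ :=
  sInf {c : ℕ∞ | ∃ n : ℕ, c = n ∧ gidLE R M n}

/-- The depth of a module over a local ring: the supremum of the lengths of regular
sequences contained in the maximal ideal. -/
noncomputable def mdepth [IsLocalRing R] (M : Type u) [AddCommGroup M] [Module R M] : ℕ∞ :=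
  sSup {c : ℕ∞ | ∃ rs : List R, c = rs.length ∧
    (∀ r ∈ rs, r ∈ IsLocalRing.maximalIdeal R) ∧ RingTheory.Sequence.IsRegular M rs}

/-- The Krull dimension of a module: the Krull dimension of its support. -/
noncomputable def mdim (M : Type u) [AddCommGroup M] [Module R M] : WithBot ℕ∞ :=
  Order.krullDim ↥(Module.support R M)

/-- The height of a prime in the support of `M`. -/
noncomputable def htM (M : Type u) [AddCommGroup M] [Module R M] (p : PrimeSpectrum R) : ℕ∞ :=
  ⨆ h : p ∈ Module.support R M, Order.height (⟨p, h⟩ : ↥(Module.support R M))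

/-- A Cohen–Macaulay module over a local ring: depth equals Krull dimension. -/
def IsCMModule [IsLocalRing R] (M : Type u) [AddCommGroup M] [Module R M] : Prop :=
  (mdepth R M : WithBot ℕ∞) = mdim R M

/-- A maximal Cohen–Macaulay module over a local ring. -/
def IsMaximalCM [IsLocalRing R] (M : Type u) [AddCommGroup M] [Module R M] : Prop :=
  IsCMModule R M ∧ mdim R M = ringKrullDim R

/-- A Cohen–Macaulay local ring. -/
def IsCMLocalRing [IsLocalRing R] : Prop :=
  (mdepth R R : WithBot ℕ∞) = ringKrullDim R

/-- A Gorenstein local ring: a Noetherian local ring of finite self-injective dimension. -/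
def IsGorensteinLocalRing [IsLocalRing R] : Prop :=
  IsNoetherianRing R ∧ ∃ n : ℕ, idLE R R n

/-- A regular local ring: Noetherian, and the maximal ideal is generated by `dim R` elements. -/
def IsRegularLocal [IsLocalRing R] : Prop :=
  IsNoetherianRing R ∧ ∃ s : Finset R, Ideal.span (s : Set R) = IsLocalRing.maximalIdeal R ∧
    (s.card : WithBot ℕ∞) = ringKrullDim R

/-- A (not necessarily local) Gorenstein ring: all localizations at primes are Gorenstein. -/
def IsGorensteinRing : Prop :=
  ∀ p : PrimeSpectrum R, ∃ n : ℕ,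
    idLE (Localization.AtPrime p.asIdeal) (Localization.AtPrime p.asIdeal) n

/-- `R` admits a dualizing complex; by Kawasaki's theorem this is equivalent to being a
homomorphic image of a finite-dimensional Gorenstein ring. -/
def HasDualizingComplex : Prop :=
  ∃ Q : CommRingCat.{u}, IsNoetherianRing Q ∧ ringKrullDim Q < ⊤ ∧ IsGorensteinRing Q ∧
    ∃ f : Q →+* R, Function.Surjective f

section Cousin

/-- The product of the localizations of `N` at the primes in `S`. -/
noncomputable abbrev locProd (S : Set (PrimeSpectrum R)) (N : Type u) [AddCommGroup N]
    [Module R N] : Type u :=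
  Π p : S, LocalizedModule p.1.asIdeal.primeCompl N

/-- The submodule of the product of localizations consisting of finitely supported families;
this is the direct sum `⊕_{p ∈ S} N_p`. -/
noncomputable def finSupp (S : Set (PrimeSpectrum R)) (N : Type u) [AddCommGroup N]
    [Module R N] : Submodule R (locProd R S N) where
  carrier := {f | {p : S | f p ≠ 0}.Finite}
  add_mem' := by
    intro f g hf hg
    refine (hf.union hg).subset ?_
    intro p hp
    by_contra h
    simp only [Set.mem_union, Set.mem_setOf_eq, not_or, not_not] at h
    exact hp (by simp [Pi.add_apply, h.1, h.2])
  zero_mem' := by simp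
  smul_mem' := by
    intro c f hf
    refine hf.subset ?_
    intro p hp
    by_contra h
    simp only [Set.mem_setOf_eq, not_not] at h
    exact hp (by simp [Pi.smul_apply, h])

/-- The canonical map `N → ∏_{p ∈ S} N_p`. -/
noncomputable def thetaFull (S : Set (PrimeSpectrum R)) (N : Type u) [AddCommGroup N]
    [Module R N] : N →ₗ[R] locProd R S N :=
  LinearMap.pi fun p => LocalizedModule.mkLinearMap p.1.asIdeal.primeCompl N

/-- The cokernel of `N → ⊕_{p ∈ S} N_p` (computed inside the direct sum). -/
noncomputable abbrev nextKType (S : Set (PrimeSpectrum R)) (N : Type u) [AddCommGroup N]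
    [Module R N] : Type u :=
  ↥(finSupp R S N) ⧸
    (Submodule.comap (finSupp R S N).subtype (LinearMap.range (thetaFull R S N)))

/-- The sequence of "kernel/cokernel" modules in the inductive construction
of the Cousin complex of `M` with respect to the filtration `F`. -/
noncomputable def cousinK (F : ℕ → Set (PrimeSpectrum R)) (M : ModuleCat.{u} R) :
    ℕ → ModuleCat.{u} R
  | 0 => M
  | n + 1 => ModuleCat.of R (nextKType R (F n \ F (n + 1)) (cousinK F M n))

/-- The `n`-th term `M^n = ⊕_{p ∈ ∂F_n} (coker d^{n-2})_p` of the Cousin complex. -/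
noncomputable abbrev cousinC (F : ℕ → Set (PrimeSpectrum R)) (M : ModuleCat.{u} R) (n : ℕ) :
    Type u :=
  ↥(finSupp R (F n \ F (n + 1)) (cousinK R F M n))

/-- The canonical map from the `n`-th cokernel into the product of its localizations. -/
noncomputable def cousinTheta (F : ℕ → Set (PrimeSpectrum R)) (M : ModuleCat.{u} R) (n : ℕ) :
    (cousinK R F M n) →ₗ[R] locProd R (F n \ F (n + 1)) (cousinK R F M n) :=
  thetaFull R _ _

/-- The (full) `n`-th differential of the Cousin complex, from `M^n` to the product at
level `n+1` (it lands inside the direct sum `M^{n+1}`). -/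
noncomputable def cousinD (F : ℕ → Set (PrimeSpectrum R)) (M : ModuleCat.{u} R) (n : ℕ) :
    (cousinC R F M n) →ₗ[R] locProd R (F (n + 1) \ F (n + 2)) (cousinK R F M (n + 1)) :=
  (cousinTheta R F M (n + 1)).comp
    (Submodule.mkQ (Submodule.comap (finSupp R (F n \ F (n + 1)) (cousinK R F M n)).subtype
      (LinearMap.range (thetaFull R (F n \ F (n + 1)) (cousinK R F M n)))))

/-- `F` is a filtration of `Spec R`: descending, and every element of `∂F_n = F_n \ F_{n+1}`
is a minimal member of `F_n`. -/
def IsFiltration (F : ℕ → Set (PrimeSpectrum R)) : Prop :=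
  (∀ n, F (n + 1) ⊆ F n) ∧
    ∀ n, ∀ p ∈ F n \ F (n + 1), ∀ q ∈ F n, q ≤ p → q = p

/-- The filtration `F` admits `M`. -/
def Admits (F : ℕ → Set (PrimeSpectrum R)) (M : Type u) [AddCommGroup M] [Module R M] : Prop :=
  Module.support R M ⊆ F 0

/-- The `M`-height filtration `K_i = {p ∈ Supp M | ht_M p ≥ i}`. -/
noncomputable def heightFiltration (M : Type u) [AddCommGroup M] [Module R M] :
    ℕ → Set (PrimeSpectrum R) :=
  fun i => {p | p ∈ Module.support R M ∧ (i : ℕ∞) ≤ htM R M p}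

/-- The Cousin complex `C(F, M)` is exact at `M, M⁰, …, M^t`
(together with the well-definedness of the differentials into the direct sums). -/
def CousinPartiallyExact (F : ℕ → Set (PrimeSpectrum R)) (M : ModuleCat.{u} R) (t : ℕ) : Prop :=
  (∀ n, LinearMap.range (cousinTheta R F M n) ≤ finSupp R (F n \ F (n + 1)) (cousinK R F M n)) ∧
  Function.Injective (cousinTheta R F M 0) ∧
  (∀ n ≤ t, LinearMap.ker (cousinD R F M n) =
    Submodule.comap (finSupp R (F n \ F (n + 1)) (cousinK R F M n)).subtype
      (LinearMap.range (cousinTheta R F M n)))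

/-- The Cousin complex `C(F, M)` is exact and all of its terms satisfy `P`, i.e. it provides
a `P`-resolution of `M`. -/
def CousinResolves (F : ℕ → Set (PrimeSpectrum R)) (M : ModuleCat.{u} R)
    (P : ModuleCat.{u} R → Prop) : Prop :=
  (∀ n, LinearMap.range (cousinTheta R F M n) ≤ finSupp R (F n \ F (n + 1)) (cousinK R F M n)) ∧
  Function.Injective (cousinTheta R F M 0) ∧
  (∀ n, LinearMap.ker (cousinD R F M n) =
    Submodule.comap (finSupp R (F n \ F (n + 1)) (cousinK R F M n)).subtype
      (LinearMap.range (cousinTheta R F M n))) ∧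
  (∀ n, P (ModuleCat.of R (cousinC R F M n)))

/-- A G–Gorenstein module: a nonzero finitely generated module whose Cousin complex with
respect to the `M`-height filtration is a Gorenstein injective resolution. -/
def IsGGorenstein (M : ModuleCat.{u} R) : Prop :=
  (∃ x : M, x ≠ 0) ∧ Module.Finite R M ∧
    CousinResolves R (heightFiltration R M) M (fun N => IsGorensteinInjective R N)

/-- A Gorenstein module: a nonzero finitely generated module whose Cousin complex with
respect to the `M`-height filtration is an injective resolution. -/
def IsGorensteinModule (M : ModuleCat.{u} R) : Prop :=
  (∃ x : M, x ≠ 0) ∧ Module.Finite R M ∧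
    CousinResolves R (heightFiltration R M) M (fun N => Module.Injective R N)

end Cousin

/-- A system of parameters of a local ring. -/
def IsSOP [IsLocalRing R] (rs : List R) : Prop :=
  (rs.length : WithBot ℕ∞) = ringKrullDim R ∧
    (∀ r ∈ rs, r ∈ IsLocalRing.maximalIdeal R) ∧
    IsLocalRing.maximalIdeal R ≤ (Ideal.span {r | r ∈ rs}).radical

/-- A balanced big Cohen–Macaulay module: every system of parameters of `R` is a regular
sequence on `M`. -/
def IsBalancedBigCM [IsLocalRing R] (M : Type u) [AddCommGroup M] [Module R M] : Prop :=
  ∀ rs : List R, IsSOP R rs → RingTheory.Sequence.IsRegular M rs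

end GG

namespace GG

section CharFlat

lemma char_sum_apply {A ι : Type*} [AddCommGroup A] (s : Finset ι) (c : ι → CharacterModule A)
    (x : A) : (∑ i ∈ s, c i) x = ∑ i ∈ s, c i x := by
  classical
  induction s using Finset.induction_on with
  | empty => rfl
  | insert a s ha ih => rw [Finset.sum_insert ha, Finset.sum_insert ha, ← ih]; rfl

lemma char_add_apply {A : Type*} [AddCommGroup A] (c c' : CharacterModule A)
    (x : A) : (c + c') x = c x + c' x := rfl

lemma char_factor {A B : Type*} [AddCommGroup A] [AddCommGroup B] (f : A →+ B)
    (c : CharacterModule A) (h : ∀ a, f a = 0 → c a = 0) :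
    ∃ c' : CharacterModule B, ∀ a, c a = c' (f a) := by
  let g : (A ⧸ f.ker) →+ B := QuotientAddGroup.kerLift f
  have hg : Function.Injective g := QuotientAddGroup.kerLift_injective f
  let c0 : CharacterModule (A ⧸ f.ker) :=
    QuotientAddGroup.lift f.ker (c : A →+ AddCircle (1 : ℚ)) (fun a ha => h a ha)
  obtain ⟨c', hc'⟩ := CharacterModule.dual_surjective_of_injective (R := ℤ)
    g.toIntLinearMap hg c0
  refine ⟨c', fun a => ?_⟩
  have := DFunLike.congr_fun hc' (QuotientAddGroup.mk a)
  exact this.symm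

variable {R : Type u} [CommRing R] [IsNoetherianRing R]

lemma flat_char_of_injective (X : Type u) [AddCommGroup X] [Module R X]
    [hX : Module.Injective R X] : Module.Flat R (CharacterModule X) := by
  rw [Module.Flat.iff_forall_isTrivialRelation]
  intro l f c hc
  let φ : (Fin l → R) →ₗ[R] R := Fintype.linearCombination R f
  have hfg : (LinearMap.ker φ).FG := IsNoetherian.noetherian _
  obtain ⟨k, a, ha⟩ := Submodule.fg_iff_exists_fin_generating_family.1 hfg
  have hmem : ∀ j, ∑ i, f i * a j i = 0 := fun j => by
    have : a j ∈ LinearMap.ker φ := ha ▸ Submodule.subset_span ⟨j, rfl⟩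
    simpa [φ, Fintype.linearCombination_apply, mul_comm] using this
  let B : (Fin l → X) →ₗ[R] (Fin k → X) :=
    LinearMap.pi fun j => ∑ i, (a j i) • LinearMap.proj i
  let C : CharacterModule (Fin l → X) :=
    ∑ i, CharacterModule.dual (LinearMap.proj (R := R) (φ := fun _ : Fin l => X) i) (c i)
  have hC : ∀ x, C x = ∑ i, c i (x i) := fun x => by
    rw [char_sum_apply]; rfl
  obtain ⟨C', hC'⟩ := char_factor B.toAddMonoidHom C (by
    intro x hx
    let ψ : (Fin l → R) →ₗ[R] X := Fintype.linearCombination R x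
    have hle : LinearMap.ker φ ≤ LinearMap.ker ψ := by
      rw [← ha, Submodule.span_le]
      rintro _ ⟨j, rfl⟩
      have := congrFun hx j
      simpa [B, ψ, Fintype.linearCombination_apply] using this
    let ψ' : LinearMap.range φ →ₗ[R] X :=
      ((LinearMap.ker φ).liftQ ψ hle).comp φ.quotKerEquivRange.symm.toLinearMap
    obtain ⟨h, hh⟩ := hX.out (LinearMap.range φ).subtype
      Subtype.val_injective ψ'
    have hx' : ∀ i, x i = f i • h 1 := fun i => by
      have h1 := hh ⟨φ (Pi.single i 1), ⟨_, rfl⟩⟩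
      have h2 : ψ' ⟨φ (Pi.single i 1), ⟨_, rfl⟩⟩ = ψ (Pi.single i 1) := by
        have : φ.quotKerEquivRange.symm ⟨φ (Pi.single i 1), ⟨_, rfl⟩⟩ =
          Submodule.Quotient.mk (Pi.single i 1) := by
          rw [LinearEquiv.symm_apply_eq]; rfl
        simp only [ψ', LinearMap.comp_apply, LinearEquiv.coe_coe, this]
        rfl
      rw [h2] at h1
      have h3 : ψ (Pi.single i 1) = x i := by
        simp [ψ, Fintype.linearCombination_apply_single]
      have h4 : φ (Pi.single i 1) = f i := by
        simp [φ, Fintype.linearCombination_apply_single]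
      rw [h3] at h1
      rw [← h1]
      simp only [Submodule.subtype_apply, h4]
      rw [← map_smul]; simp
    rw [hC]
    have := DFunLike.congr_fun hc (h 1)
    rw [← show (∑ i, f i • c i) (h 1) = 0 from this]
    rw [char_sum_apply]
    refine Finset.sum_congr rfl fun i _ => ?_
    rw [hx' i]; rfl)
  refine ⟨k, fun i j => a j i, fun j =>
    CharacterModule.dual (LinearMap.single R (fun _ => X) j) C', ?_, hmem⟩
  intro i
  ext x
  have h1 := hC' (Pi.single i x)
  have h2 : C (Pi.single i x) = c i x := by
    rw [hC, Finset.sum_eq_single i]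
    · simp
    · intro j _ hj; simp [hj]
    · simp
  rw [← h2, h1]
  rw [char_sum_apply]
  have h3 : B.toAddMonoidHom (Pi.single i x) = ∑ j, Pi.single j (a j i • x) := by
    ext j
    simp [B, Pi.single_apply]
  rw [h3]
  rw [map_sum]
  rfl

lemma injective_of_flat_char (N : Type u) [AddCommGroup N] [Module R N]
    [hN : Module.Flat R (CharacterModule N)] : Module.Injective R N := by
  rw [← Module.Baer.iff_injective]
  intro I g
  obtain ⟨l, f, hf⟩ := Submodule.fg_iff_exists_fin_generating_family.1
    (IsNoetherian.noetherian I)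
  have hfm : ∀ i, f i ∈ I := fun i => hf ▸ Submodule.subset_span ⟨i, rfl⟩
  let D : N →ₗ[R] (Fin l → N) := LinearMap.pi fun i => f i • LinearMap.id
  let n : Fin l → N := fun i => g ⟨f i, hfm i⟩
  have key : n ∈ LinearMap.range D := by
    by_contra hn
    have : (Submodule.Quotient.mk n : _ ⧸ LinearMap.range D) ≠ 0 := by
      rwa [Ne, Submodule.Quotient.mk_eq_zero]
    obtain ⟨c, hc⟩ := CharacterModule.exists_character_apply_ne_zero_of_ne_zero this
    let C : CharacterModule (Fin l → N) :=
      CharacterModule.dual (LinearMap.range D).mkQ c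
    have hCn : C n ≠ 0 := hc
    have hCD : ∀ y, C (D y) = 0 := fun y => by
      change c ((LinearMap.range D).mkQ (D y)) = 0
      have : (LinearMap.range D).mkQ (D y) = 0 := by simp
      rw [this, map_zero]
    let ci : Fin l → CharacterModule N := fun i =>
      CharacterModule.dual (LinearMap.single R (fun _ => N) i) C
    have hCx : ∀ x, C x = ∑ i, ci i (x i) := fun x => by
      conv_lhs => rw [← Finset.univ_sum_single x]
      rw [map_sum]; rfl
    have hrel : ∑ i, f i • ci i = 0 := by
      ext y
      have := hCD y
      rw [hCx] at this
      rw [show (0 : CharacterModule N) y = 0 from rfl, ← this]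
      rw [char_sum_apply]
      rfl
    obtain ⟨k, a, y, h1, h2⟩ := Module.Flat.isTrivialRelation_of_sum_smul_eq_zero hrel
    apply hCn
    rw [hCx]
    have h3 : ∀ i, ci i (n i) = ∑ j, y j (a i j • n i) := fun i => by
      rw [h1 i]
      rw [char_sum_apply]
      rfl
    simp_rw [h3]
    rw [Finset.sum_comm]
    refine Finset.sum_eq_zero fun j _ => ?_
    rw [← map_sum]
    have : ∑ i, a i j • n i = 0 := by
      have : ∑ i, a i j • n i = g ⟨∑ i, f i * a i j, I.sum_mem fun i _ =>
          I.mul_mem_right _ (hfm i)⟩ := by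
        simp only [n, ← map_smul, ← map_sum]
        congr 1
        ext
        simp [mul_comm]
      rw [this]
      have : (⟨∑ i, f i * a i j, I.sum_mem fun i _ => I.mul_mem_right _ (hfm i)⟩ : I) = 0 :=
        Subtype.ext (h2 j)
      rw [this, map_zero]
    rw [this, map_zero]
  obtain ⟨y, hy⟩ := key
  refine ⟨LinearMap.toSpanSingleton R N y, ?_⟩
  have : (LinearMap.toSpanSingleton R N y).comp I.subtype = g := by
    have hs : Submodule.span R (Set.range fun i => (⟨f i, hfm i⟩ : I)) = ⊤ := by
      apply Submodule.map_injective_of_injective (f := I.subtype) Subtype.val_injective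
      rw [Submodule.map_span, Submodule.map_top, Submodule.range_subtype, ← Set.range_comp]
      exact hf
    apply LinearMap.ext_on_range hs
    intro i
    have := congrFun hy i
    simpa [D, n] using this
  intro x hx
  exact DFunLike.congr_fun this ⟨x, hx⟩

end CharFlat

end GG

namespace GG

section Fd
open TensorProduct

variable {R : Type u} [CommRing R]

/-- Finite flat dimension, inductively. -/
def FlatDim : ℕ → ModuleCat.{u} R → Prop
  | 0, W => Module.Flat R W
  | n + 1, W => ∃ (F W' : ModuleCat.{u} R) (i : W' →ₗ[R] F) (q : F →ₗ[R] W),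
      Module.Flat R F ∧ Function.Injective i ∧ Function.Exact i q ∧ Function.Surjective q ∧
      FlatDim n W'

lemma flatDim_of_fdLE (n : ℕ) : ∀ (W : ModuleCat.{u} R), fdLE R W n → FlatDim n W := by
  induction n with
  | zero =>
    rintro W ⟨G, d, ε, hG, hε, h0, hd, hz⟩
    have : Module.Flat R (G 0) := hG 0
    have hinj : Function.Injective ε := by
      rw [← LinearMap.ker_eq_bot, h0, LinearMap.range_eq_bot]
      ext x
      rw [hz 1 (by omega) x]; simp
    exact Module.Flat.of_linearEquiv (LinearEquiv.ofBijective ε ⟨hinj, hε⟩).symm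
  | succ n ih =>
    rintro W ⟨G, d, ε, hG, hε, h0, hd, hz⟩
    refine ⟨G 0, ModuleCat.of R (LinearMap.ker ε), (LinearMap.ker ε).subtype, ε, hG 0,
      Subtype.val_injective, ?_, hε, ih _ ?_⟩
    · rw [LinearMap.exact_iff]; simp
    · refine ⟨fun i => G (i + 1), fun i => d (i + 1),
        (d 0).codRestrict (LinearMap.ker ε) (fun x => h0 ▸ ⟨x, rfl⟩), fun i => hG _, ?_, ?_,
        fun i => hd _, fun i hi => hz _ (by omega)⟩
      · rintro ⟨y, hy⟩
        rw [h0] at hy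
        obtain ⟨x, rfl⟩ := hy
        exact ⟨x, rfl⟩
      · rw [← hd 0]
        ext x
        simp [LinearMap.codRestrict, Subtype.ext_iff]

lemma chase {A G B W' F W : Type u} [AddCommGroup A] [Module R A] [AddCommGroup G] [Module R G]
    [AddCommGroup B] [Module R B] [AddCommGroup W'] [Module R W'] [AddCommGroup F] [Module R F]
    [AddCommGroup W] [Module R W] (α : A →ₗ[R] G) (β : G →ₗ[R] B) (i : W' →ₗ[R] F)
    (q : F →ₗ[R] W) [Module.Flat R F] (hα : Function.Injective α) (hαβ : Function.Exact α β)
    (hβ : Function.Surjective β) (hiq : Function.Exact i q) (hq : Function.Surjective q)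
    (hB : Function.Injective (i.lTensor B)) : Function.Injective (α.rTensor W) := by
  rw [injective_iff_map_eq_zero]
  intro a ha
  obtain ⟨a1, rfl⟩ := LinearMap.lTensor_surjective A hq a
  have h1 : (q.lTensor G) (α.rTensor F a1) = 0 := by
    rw [← ha, ← LinearMap.comp_apply, ← LinearMap.comp_apply, LinearMap.lTensor_comp_rTensor,
      LinearMap.rTensor_comp_lTensor]
  obtain ⟨g, hg⟩ := (lTensor_exact G hiq hq _).1 h1
  have h2 : i.lTensor B (β.rTensor W' g) = 0 := by
    rw [← LinearMap.comp_apply, LinearMap.lTensor_comp_rTensor, ← LinearMap.rTensor_comp_lTensor,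
      LinearMap.comp_apply, hg]
    exact (rTensor_exact F hαβ hβ _).2 ⟨_, rfl⟩
  have h3 : β.rTensor W' g = 0 := hB (by rw [h2, map_zero])
  obtain ⟨a', rfl⟩ := (rTensor_exact W' hαβ hβ _).1 h3
  have h4 : i.lTensor A a' = a1 := by
    apply Module.Flat.rTensor_preserves_injective_linearMap (M := F) α hα
    rw [← hg, ← LinearMap.comp_apply, ← LinearMap.comp_apply, LinearMap.lTensor_comp_rTensor,
      LinearMap.rTensor_comp_lTensor]
  rw [← h4]
  exact (lTensor_exact A hiq hq _).2 ⟨_, rfl⟩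

lemma char_exact {A G B : Type*} [AddCommGroup A] [Module R A] [AddCommGroup G] [Module R G]
    [AddCommGroup B] [Module R B] (α : A →ₗ[R] G) (β : G →ₗ[R] B) (h : Function.Exact α β) :
    Function.Exact (CharacterModule.dual β) (CharacterModule.dual α) := by
  intro c
  constructor
  · intro hc
    obtain ⟨c', hc'⟩ := char_factor β.toAddMonoidHom c (fun a ha => by
      obtain ⟨x, rfl⟩ := (h a).1 ha
      exact DFunLike.congr_fun hc x)
    exact ⟨c', by ext a; exact (hc' a).symm⟩
  · rintro ⟨c', rfl⟩
    ext a
    change c' (β (α a)) = 0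
    rw [h.apply_apply_eq_zero, map_zero]

variable [IsNoetherianRing R]

/-- the surjection `X n → ker d (n+1)` -/
def toKer (X : ℤ → ModuleCat.{u} R) (d : ∀ n : ℤ, X n →ₗ[R] X (n + 1))
    (he : ∀ n, LinearMap.range (d n) = LinearMap.ker (d (n + 1))) (n : ℤ) :
    X n →ₗ[R] LinearMap.ker (d (n + 1)) :=
  (d n).codRestrict _ (fun x => he n ▸ ⟨x, rfl⟩)

lemma toKer_surj (X : ℤ → ModuleCat.{u} R) (d : ∀ n : ℤ, X n →ₗ[R] X (n + 1))
    (he : ∀ n, LinearMap.range (d n) = LinearMap.ker (d (n + 1))) (n : ℤ) :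
    Function.Surjective (toKer X d he n) := by
  rintro ⟨y, hy⟩
  rw [← he n] at hy
  obtain ⟨x, rfl⟩ := hy
  exact ⟨x, rfl⟩

lemma inj_tensor (X : ℤ → ModuleCat.{u} R) (d : ∀ n : ℤ, X n →ₗ[R] X (n + 1))
    (hX : ∀ n, Module.Injective R (X n))
    (he : ∀ n, LinearMap.range (d n) = LinearMap.ker (d (n + 1))) (k : ℕ) :
    ∀ (W : ModuleCat.{u} R), FlatDim k W → ∀ n : ℤ,
      Function.Injective ((CharacterModule.dual (toKer X d he n)).rTensor W) := by
  induction k with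
  | zero =>
    intro W hW n
    have : Module.Flat R W := hW
    exact Module.Flat.rTensor_preserves_injective_linearMap _
      (CharacterModule.dual_injective_of_surjective _ (toKer_surj X d he n))
  | succ k ih =>
    rintro W ⟨F, W', i, q, hF, hi, hiq, hq, hW'⟩ n
    obtain ⟨n, rfl⟩ : ∃ n', n = n' + 1 := ⟨n - 1, by ring⟩
    refine chase (CharacterModule.dual (toKer X d he (n + 1)))
      (CharacterModule.dual (LinearMap.ker (d (n + 1))).subtype) i q
      (CharacterModule.dual_injective_of_surjective _ (toKer_surj X d he (n + 1))) ?_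
      (CharacterModule.dual_surjective_of_injective _ Subtype.val_injective) hiq hq ?_
    · apply char_exact
      rw [LinearMap.exact_iff]
      ext x
      simp [toKer, Subtype.ext_iff, LinearMap.codRestrict]
    · have h1 := ih W' hW' n
      have : Module.Flat R (CharacterModule (X n)) := by
        have := hX n
        exact flat_char_of_injective _
      have h2 : Function.Injective (i.lTensor (CharacterModule (X n))) :=
        Module.Flat.lTensor_preserves_injective_linearMap _ hi
      have h3 := h2.comp h1
      have h4 : (i.lTensor (CharacterModule (X n))) ∘
          ((CharacterModule.dual (toKer X d he n)).rTensor W') =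
          ((CharacterModule.dual (toKer X d he n)).rTensor F) ∘
            (i.lTensor (CharacterModule (LinearMap.ker (d (n + 1))))) := by
        rw [← LinearMap.coe_comp, ← LinearMap.coe_comp, LinearMap.lTensor_comp_rTensor,
          LinearMap.rTensor_comp_lTensor]
      rw [h4] at h3
      exact h3.of_comp

/-- Gorenstein injective modules of finite flat dimension are injective. -/
lemma injective_of_gorensteinInjective_fd (N : ModuleCat.{u} R) (hN : IsGorensteinInjective R N)
    (k : ℕ) (hk : FlatDim k N) : Module.Injective R N := by
  obtain ⟨X, d, hX, he, -, ⟨e⟩⟩ := hN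
  have h0 : ∃ n : ℤ, n + 1 = 0 := ⟨-1, by ring⟩
  obtain ⟨n, hn⟩ := h0
  rw [← hn] at e
  have h1 := inj_tensor X d hX he k N hk n
  rw [rTensor_injective_iff_lcomp_surjective] at h1
  obtain ⟨s, hs⟩ := h1 (CharacterModule.congr e).symm.toLinearMap
  have := hX n
  have hf := flat_char_of_injective (R := R) (X n)
  have : Module.Flat R (CharacterModule N) := by
    refine Module.Flat.of_retract
      ((CharacterModule.dual (toKer X d he n)).comp (CharacterModule.congr e).toLinearMap) s ?_
    ext c a
    have := DFunLike.congr_fun hs (CharacterModule.congr e c)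
    simp only [LinearMap.lcomp_apply] at this
    simp only [LinearMap.comp_apply, LinearEquiv.coe_coe, this]
    simp
  exact injective_of_flat_char N

end Fd
end GG

namespace GG

section ExtBasics
open CategoryTheory Abelian

variable {R : Type u} [CommRing R]

/-- Short complex from linear maps. -/
abbrev sc {A B C : ModuleCat.{u} R} (f : A →ₗ[R] B) (g : B →ₗ[R] C)
    (h : Function.Exact f g) : ShortComplex (ModuleCat.{u} R) :=
  ShortComplex.mk (ModuleCat.ofHom f) (ModuleCat.ofHom g)
    (by ext x; exact h.apply_apply_eq_zero x)

lemma sc_se {A B C : ModuleCat.{u} R} (f : A →ₗ[R] B) (g : B →ₗ[R] C)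
    (h : Function.Exact f g) (hf : Function.Injective f) (hg : Function.Surjective g) :
    (sc f g h).ShortExact :=
  ModuleCat.shortComplex_shortExact _ h hf hg

lemma ext_shift {S : ShortComplex (ModuleCat.{u} R)} (hS : S.ShortExact) [Projective S.X₂]
    (V : ModuleCat.{u} R) (i : ℕ) :
    Subsingleton (Ext.{u} S.X₃ V (i + 2)) ↔ Subsingleton (Ext.{u} S.X₁ V (i + 1)) := by
  constructor
  · intro h
    refine subsingleton_of_forall_eq 0 fun e => ?_
    obtain ⟨x2, rfl⟩ := Ext.contravariant_sequence_exact₁ hS V e (n₁ := i + 2) (by omega)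
      (Subsingleton.elim _ _)
    rw [Ext.eq_zero_of_projective x2, Ext.comp_zero]
  · intro h
    refine subsingleton_of_forall_eq 0 fun e => ?_
    obtain ⟨x1, rfl⟩ := Ext.contravariant_sequence_exact₃ hS V e
      (Ext.eq_zero_of_projective _) (n₀ := i + 1) (by omega)
    rw [Subsingleton.elim x1 0, Ext.comp_zero]

lemma ext_one_iff {S : ShortComplex (ModuleCat.{u} R)} (hS : S.ShortExact) [Projective S.X₂]
    (V : ModuleCat.{u} R) :
    Subsingleton (Ext.{u} S.X₃ V 1) ↔ ∀ φ : S.X₁ →ₗ[R] V, ∃ ψ : S.X₂ →ₗ[R] V,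
      ψ.comp S.f.hom = φ := by
  constructor
  · intro h φ
    obtain ⟨x2, hx2⟩ := Ext.contravariant_sequence_exact₁ hS V (Ext.mk₀ (ModuleCat.ofHom φ))
      (n₁ := 1) (by omega) (Subsingleton.elim _ _)
    obtain ⟨ψ, rfl⟩ := Ext.homEquiv₀.symm.surjective x2
    simp only [Ext.homEquiv₀_symm_apply, Ext.mk₀_comp_mk₀] at hx2
    refine ⟨ψ.hom, ?_⟩
    have := Ext.homEquiv₀.symm.injective hx2
    rw [← ModuleCat.hom_comp, this]; rfl
  · intro h
    refine subsingleton_of_forall_eq 0 fun e => ?_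
    obtain ⟨x1, rfl⟩ := Ext.contravariant_sequence_exact₃ hS V e
      (Ext.eq_zero_of_projective _) (n₀ := 0) (by omega)
    obtain ⟨φ, rfl⟩ := Ext.homEquiv₀.symm.surjective x1
    obtain ⟨ψ, hψ⟩ := h φ.hom
    have : φ = S.f ≫ ModuleCat.ofHom ψ := by
      ext x; exact (LinearMap.congr_fun hψ x).symm
    rw [this, Ext.homEquiv₀_symm_apply, ← Ext.mk₀_comp_mk₀, ← Ext.comp_assoc_of_third_deg_zero,
      hS.extClass_comp, Ext.zero_comp]

lemma injective_of_ext_ideal (V : ModuleCat.{u} R)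
    (h : ∀ I : Ideal R, Subsingleton (Ext.{u} (ModuleCat.of R (R ⧸ I)) V 1)) :
    Module.Injective R V := by
  rw [← Module.Baer.iff_injective, Module.Baer.iff_surjective]
  intro I φ
  have hS := sc_se (A := ModuleCat.of R I) (B := ModuleCat.of R R) (C := ModuleCat.of R (R ⧸ I))
    (Submodule.subtype I) (Submodule.mkQ I)
    (by rw [LinearMap.exact_iff]; simp) Subtype.val_injective (Submodule.mkQ_surjective I)
  have : Projective (sc (A := ModuleCat.of R I) (B := ModuleCat.of R R)
    (C := ModuleCat.of R (R ⧸ I)) (Submodule.subtype I) (Submodule.mkQ I)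
    (by rw [LinearMap.exact_iff]; simp)).X₂ :=
    inferInstanceAs (Projective (ModuleCat.of R R))
  obtain ⟨ψ, hψ⟩ := (ext_one_iff hS V).1 (h I) φ
  exact ⟨ψ, hψ⟩

/-- embedding into an injective with cokernel -/
lemma exists_inj_coker (V : ModuleCat.{u} R) : ∃ (J C : ModuleCat.{u} R) (f : V →ₗ[R] J)
    (g : J →ₗ[R] C), Module.Injective R J ∧ Function.Injective f ∧ Function.Exact f g ∧
      Function.Surjective g := by
  let ⟨I, _, f, _⟩ := EnoughInjectives.presentation V
  exact ⟨I, ModuleCat.of R (I ⧸ LinearMap.range f.hom), f.hom, Submodule.mkQ _,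
    Module.injective_module_of_injective_object R I, (ModuleCat.mono_iff_injective f).1 ‹_›,
    f.hom.exact_map_mkQ_range, Submodule.mkQ_surjective _⟩

lemma ext_coshift {S : ShortComplex (ModuleCat.{u} R)} (hS : S.ShortExact)
    (A : ModuleCat.{u} R) (i : ℕ) (h2 : Subsingleton (Ext.{u} A S.X₂ (i + 1)))
    (h : Subsingleton (Ext.{u} A S.X₁ (i + 2))) :
    Subsingleton (Ext.{u} A S.X₃ (i + 1)) := by
  refine subsingleton_of_forall_eq 0 fun e => ?_
  obtain ⟨x2, rfl⟩ := Ext.covariant_sequence_exact₃ A hS e (n₁ := i + 2) (by omega)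
      (Subsingleton.elim _ _)
  rw [Subsingleton.elim x2 0, Ext.zero_comp]

lemma hasInj_of_ideal (n : ℕ) : ∀ (V : ModuleCat.{u} R)
    (_ : ∀ I : Ideal R, Subsingleton (Ext.{u} (ModuleCat.of R (R ⧸ I)) V (n + 1))),
    HasInjectiveDimensionLT V (n + 1) := by
  induction n with
  | zero =>
    intro V h
    rw [← injective_iff_hasInjectiveDimensionLT_one, ← Module.injective_iff_injective_object]
    exact injective_of_ext_ideal V h
  | succ n ih =>
    intro V h
    obtain ⟨J, C, f, g, hJ, hf, hfg, hg⟩ := exists_inj_coker V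
    have hJ' : Injective J := Module.injective_object_of_injective_module R J
    have hS := sc_se f g hfg hf hg
    refine (hS.hasInjectiveDimensionLT_X₃_iff n hJ').1 (ih _ fun I => ?_)
    refine ext_coshift hS _ n ?_ (h I)
    exact subsingleton_of_forall_eq 0 fun e => Ext.eq_zero_of_injective (I := J) e

lemma idLE_of_hasInj (n : ℕ) : ∀ (V : ModuleCat.{u} R), HasInjectiveDimensionLT V (n + 1) →
    idLE R V n := by
  induction n with
  | zero =>
    intro V h
    have hV : Module.Injective R V :=
      (Module.injective_iff_injective_object R V).2 (injective_iff_hasInjectiveDimensionLT_one.2 h)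
    have hz : Module.Injective R PUnit.{u+1} :=
      (Module.Baer.iff_injective (R := R)).1 fun I g => ⟨0, fun x m => Subsingleton.elim _ _⟩
    refine ⟨fun | 0 => V | _ + 1 => ModuleCat.of R PUnit, fun _ => 0, LinearMap.id, ?_,
      fun _ _ h => h, ?_, ?_, ?_⟩
    · rintro (_ | i)
      · exact hV
      · exact hz
    · simp
    · intro i; ext x; simp
    · rintro (_ | i) hi x
      · omega
      · exact Subsingleton.elim (α := PUnit) _ _
  | succ n ih =>
    intro V h
    obtain ⟨J, C, f, g, hJ, hf, hfg, hg⟩ := exists_inj_coker V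
    have hJ' : Injective J := Module.injective_object_of_injective_module R J
    have hS := sc_se f g hfg hf hg
    obtain ⟨G, d, ε, hG, hε, h0, hd, hz⟩ := ih C ((hS.hasInjectiveDimensionLT_X₃_iff n hJ').2 h)
    refine ⟨fun | 0 => J | i + 1 => G i, fun | 0 => ε.comp g | i + 1 => d i, f, ?_, hf, ?_, ?_, ?_⟩
    · rintro (_ | i)
      · exact hJ
      · exact hG i
    · change LinearMap.range f = LinearMap.ker (ε.comp g)
      rw [LinearMap.ker_comp, LinearMap.ker_eq_bot.2 hε, Submodule.comap_bot,
        (LinearMap.exact_iff).1 hfg]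
    · rintro (_ | i)
      · change LinearMap.range (ε.comp g) = LinearMap.ker (d 0)
        rw [LinearMap.range_comp, LinearMap.range_eq_top.2 hg, Submodule.map_top, h0]
      · exact hd i
    · rintro (_ | i) hi x
      · omega
      · exact hz i (by omega) x

end ExtBasics
end GG

namespace GG

section RGor
open CategoryTheory Abelian TensorProduct

variable {R : Type u} [CommRing R]

lemma dth_bij (P V : Type u) [AddCommGroup P] [Module R P] [Module.Finite R P] [Module.Free R P]
    [AddCommGroup V] [Module R V] : Function.Bijective (dualTensorHom R P V) := by
  exact dualTensorHom_bijective

lemma dth_inj (A V : Type u) [AddCommGroup A] [Module R A] [Module.Finite R A]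
    [AddCommGroup V] [Module R V] [Module.Flat R V] : Function.Injective (dualTensorHom R A V) := by
  obtain ⟨n, f, hf⟩ := Module.Finite.exists_fin' R A
  have h1 := dualTensorHom_comp_rTensor_dualMap (P := V) f
  have h2 : Function.Injective (f.dualMap.rTensor V) :=
    Module.Flat.rTensor_preserves_injective_linearMap _ (LinearMap.dualMap_injective_of_surjective hf)
  have h4 : Function.Bijective (dualTensorHom R (Fin n → R) V) :=
    dualTensorHom_bijective
  have h3 := h4.1.comp h2
  rw [← LinearMap.coe_comp, h1, LinearMap.coe_comp] at h3
  exact Function.Injective.of_comp h3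

lemma surj_descend (A P V : Type u) [AddCommGroup P] [Module R P] [Module.Finite R P]
    [Module.Free R P] [AddCommGroup V] [Module R V] [Module.FaithfullyFlat R V]
    [AddCommGroup A] [Module R A] [Module.Finite R A] (f : A →ₗ[R] P)
    (h : ∀ φ : A →ₗ[R] V, ∃ ψ : P →ₗ[R] V, ψ.comp f = φ) :
    ∀ φ : A →ₗ[R] R, ∃ ψ : P →ₗ[R] R, ψ.comp f = φ := by
  have hs : Function.Surjective (f.dualMap.rTensor V) := by
    intro t
    obtain ⟨ψ, hψ⟩ := h (dualTensorHom R A V t)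
    obtain ⟨s, rfl⟩ := (dth_bij P V).2 ψ
    refine ⟨s, dth_inj A V ?_⟩
    have := LinearMap.congr_fun (dualTensorHom_comp_rTensor_dualMap (P := V) f) s
    rw [← hψ]
    exact this
  have hs' : Function.Surjective f.dualMap := by
    rw [← Module.FaithfullyFlat.lTensor_surjective_iff_surjective R V]
    rwa [LinearMap.lTensor_surj_iff_rTensor_surj]
  intro φ
  exact hs' φ

lemma ext_descend [IsNoetherianRing R] (V : ModuleCat.{u} R) [Module.FaithfullyFlat R V] (i : ℕ) :
    ∀ (A : ModuleCat.{u} R), Module.Finite R A → Subsingleton (Ext.{u} A V (i + 1)) →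
      Subsingleton (Ext.{u} A (ModuleCat.of R R) (i + 1)) := by
  induction i with
  | zero =>
    intro A hA h
    obtain ⟨N, _, _, _, _, f, surjf⟩ := Module.exists_finite_presentation R A
    let exac := LinearMap.shortExact_shortComplexKer surjf
    have : Projective f.shortComplexKer.X₂ := inferInstanceAs (Projective (ModuleCat.of R N))
    refine (ext_one_iff exac _).2 ?_
    have := (ext_one_iff exac V).1 h
    exact surj_descend (LinearMap.ker f) N V _ this
  | succ n ih =>
    intro A hA h
    obtain ⟨N, _, _, _, _, f, surjf⟩ := Module.exists_finite_presentation R A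
    let exac := LinearMap.shortExact_shortComplexKer surjf
    have : Projective f.shortComplexKer.X₂ := inferInstanceAs (Projective (ModuleCat.of R N))
    refine (ext_shift exac _ n).2 (ih _ ?_ ((ext_shift exac _ n).1 h))
    exact inferInstanceAs (Module.Finite R (LinearMap.ker f))

lemma char_hasInj (n : ℕ) : ∀ (W : ModuleCat.{u} R), FlatDim n W →
    HasInjectiveDimensionLT (ModuleCat.of R (CharacterModule W)) (n + 1) := by
  induction n with
  | zero =>
    intro W (h : Module.Flat R W)
    rw [← injective_iff_hasInjectiveDimensionLT_one, ← Module.injective_iff_injective_object]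
    exact Module.Flat.iff_characterModule_injective.1 h
  | succ n ih =>
    rintro W ⟨F, W', i, q, hF, hi, hiq, hq, hW'⟩
    have hS := sc_se (A := ModuleCat.of R (CharacterModule W))
      (B := ModuleCat.of R (CharacterModule F)) (C := ModuleCat.of R (CharacterModule W'))
      (CharacterModule.dual q) (CharacterModule.dual i) (char_exact i q hiq)
      (CharacterModule.dual_injective_of_surjective _ hq)
      (CharacterModule.dual_surjective_of_injective _ hi)
    refine (hS.hasInjectiveDimensionLT_X₃_iff n ?_).1 (ih _ hW')
    exact Module.injective_object_of_injective_module R _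
      (inj := Module.Flat.iff_characterModule_injective.1 hF)

/-- A ring with a nonzero `m`-torsion injective module of finite flat dimension is Gorenstein. -/
theorem gorenstein_of [IsLocalRing R] [IsNoetherianRing R] (N : ModuleCat.{u} R)
    [Module.Injective R N] (n : ℕ) (hn : FlatDim n N) (x : N) (hx : x ≠ 0)
    (hm : ∀ r ∈ IsLocalRing.maximalIdeal R, r • x = 0) : ∃ n, idLE R R n := by
  have hfl : Module.Flat R (CharacterModule N) := flat_char_of_injective N
  have hff : Module.FaithfullyFlat R (CharacterModule N) := by
    rw [Module.FaithfullyFlat.iff_flat_and_proper_ideal]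
    refine ⟨hfl, fun I hI htop => ?_⟩
    obtain ⟨c, hc⟩ := CharacterModule.exists_character_apply_ne_zero_of_ne_zero hx
    have hcm : c ∈ I • (⊤ : Submodule R (CharacterModule N)) := by rw [htop]; trivial
    apply hc
    clear hc
    induction hcm using Submodule.smul_induction_on' with
    | smul r hr d _ =>
      rw [CharacterModule.smul_apply, hm r (IsLocalRing.le_maximalIdeal hI hr), map_zero]
    | add c1 _ c2 _ h1 h2 =>
      exact (char_add_apply c1 c2 x).trans (by rw [h1, h2, add_zero])
  have hV := char_hasInj n N hn
  refine ⟨n, idLE_of_hasInj n (ModuleCat.of R R) (hasInj_of_ideal n _ fun I => ?_)⟩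
  refine ext_descend (ModuleCat.of R (CharacterModule N)) n _ ?_ ?_
  · exact inferInstanceAs (Module.Finite R (R ⧸ I))
  · exact HasInjectiveDimensionLT.subsingleton _ (n + 1) _ le_rfl _

end RGor
end GG

namespace GG

section Bass
open CategoryTheory Abelian

variable {R : Type u} [CommRing R]

lemma ext_subsingleton_of_subsingleton (A M : ModuleCat.{u} R) [Subsingleton A] (i : ℕ) :
    Subsingleton (Ext.{u} A M i) := by
  refine subsingleton_of_forall_eq 0 fun e => ?_
  have h : 𝟙 A = 0 := by ext x; exact Subsingleton.elim _ _
  rw [← Ext.mk₀_id_comp e, h, Ext.mk₀_zero, Ext.zero_comp]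

lemma ext_smul_comp {A M : ModuleCat.{u} R} (r : R) {i : ℕ} (e : Ext.{u} A M i) :
    (Ext.mk₀ (r • 𝟙 A)).comp e (zero_add i) = r • e := by
  rw [Ext.mk₀_smul, Ext.smul_comp, Ext.mk₀_id_comp]

lemma ext_comp_smul {A M : ModuleCat.{u} R} (r : R) {i : ℕ} (e : Ext.{u} A M i) :
    e.comp (Ext.mk₀ (r • 𝟙 M)) (add_zero i) = r • e := by
  rw [Ext.mk₀_smul, Ext.comp_smul, Ext.comp_mk₀_id]

lemma quot_exact (I J : Ideal R) (x : R) (hJ : ∀ r, r ∈ J ↔ r * x ∈ I) :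
    ∃ (f : (R ⧸ J) →ₗ[R] (R ⧸ I)) (g : (R ⧸ I) →ₗ[R] (R ⧸ (I ⊔ Ideal.span {x}))),
      Function.Injective f ∧ Function.Exact f g ∧ Function.Surjective g ∧
      ∀ r : R, f (Submodule.Quotient.mk r) = x • Submodule.Quotient.mk r := by
  let f : (R ⧸ J) →ₗ[R] (R ⧸ I) := Submodule.mapQ J I (x • LinearMap.id) (by
    intro r hr
    simpa [mul_comm] using (hJ r).1 hr)
  let g : (R ⧸ I) →ₗ[R] (R ⧸ (I ⊔ Ideal.span {x})) := Submodule.mapQ _ _ LinearMap.id le_sup_left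
  refine ⟨f, g, ?_, ?_, ?_, fun r => ?_⟩
  · rw [injective_iff_map_eq_zero]
    intro a
    obtain ⟨r, rfl⟩ := Submodule.Quotient.mk_surjective _ a
    intro h
    rw [Submodule.Quotient.mk_eq_zero, hJ]
    have : (Submodule.Quotient.mk (x * r) : R ⧸ I) = 0 := h
    rw [Submodule.Quotient.mk_eq_zero] at this
    rwa [mul_comm]
  · intro a
    obtain ⟨r, rfl⟩ := Submodule.Quotient.mk_surjective _ a
    constructor
    · intro h
      have : (Submodule.Quotient.mk r : R ⧸ (I ⊔ Ideal.span {x})) = 0 := h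
      rw [Submodule.Quotient.mk_eq_zero] at this
      obtain ⟨y, hy, z, hz, rfl⟩ := Submodule.mem_sup.1 this
      obtain ⟨w, rfl⟩ := Ideal.mem_span_singleton.1 hz
      refine ⟨Submodule.Quotient.mk w, ?_⟩
      change (Submodule.Quotient.mk (x * w) : R ⧸ I) = _
      rw [Submodule.Quotient.eq]
      simpa using hy
    · rintro ⟨b, hb⟩
      obtain ⟨w, rfl⟩ := Submodule.Quotient.mk_surjective _ b
      have : (Submodule.Quotient.mk (x * w) : R ⧸ I) = Submodule.Quotient.mk r := hb
      rw [← this]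
      change (Submodule.Quotient.mk (x * w) : R ⧸ (I ⊔ Ideal.span {x})) = 0
      rw [Submodule.Quotient.mk_eq_zero]
      exact Submodule.mem_sup_right (Ideal.mem_span_singleton.2 ⟨w, rfl⟩)
  · intro a
    obtain ⟨r, rfl⟩ := Submodule.Quotient.mk_surjective _ a
    exact ⟨Submodule.Quotient.mk r, rfl⟩
  · rfl

theorem bass [IsLocalRing R] [IsNoetherianRing R] (M : ModuleCat.{u} R) [Module.Finite R M] (c : ℕ)
    (h : ∀ i, c ≤ i →
      Subsingleton (Ext.{u} (ModuleCat.of R (R ⧸ IsLocalRing.maximalIdeal R)) M i)) (I : Ideal R) :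
    ∀ i, c ≤ i → Subsingleton (Ext.{u} (ModuleCat.of R (R ⧸ I)) M i) := by
  induction I using IsNoetherian.induction with
  | hgt I ih =>
  by_cases htop : I = ⊤
  · subst htop
    intro i _
    have : Subsingleton (ModuleCat.of R (R ⧸ (⊤ : Ideal R))) :=
      inferInstanceAs (Subsingleton (R ⧸ (⊤ : Ideal R)))
    exact ext_subsingleton_of_subsingleton _ _ _
  by_cases hIm : I = IsLocalRing.maximalIdeal R
  · subst hIm; exact h
  have hle := IsLocalRing.le_maximalIdeal htop
  obtain ⟨x, hxm, hxI⟩ := SetLike.exists_of_lt (lt_of_le_of_ne hle hIm)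
  have hK : I < I ⊔ Ideal.span {x} := by
    refine lt_of_le_of_ne le_sup_left fun heq => hxI ?_
    rw [heq]
    exact Submodule.mem_sup_right (Ideal.mem_span_singleton_self x)
  let J : Ideal R := Submodule.comap (LinearMap.mulRight R x) I
  have hJ : ∀ r, r ∈ J ↔ r * x ∈ I := fun r => Iff.rfl
  have hIJ : I ≤ J := fun r hr => Ideal.mul_mem_right x I hr
  by_cases hJI : I = J
  · obtain ⟨f, g, hf, hfg, hg, hfx⟩ := quot_exact I I x (by rw [← hJI] at hJ; exact hJ)
    have hS := sc_se (A := ModuleCat.of R (R ⧸ I)) (B := ModuleCat.of R (R ⧸ I))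
      (C := ModuleCat.of R (R ⧸ (I ⊔ Ideal.span {x}))) f g hfg hf hg
    intro i hi
    have key : ∀ e : Ext.{u} (ModuleCat.of R (R ⧸ I)) M i, ∃ e', x • e' = e := by
      intro e
      have := ih _ hK (i + 1) (by omega)
      obtain ⟨x2, hx2⟩ := Ext.contravariant_sequence_exact₁ hS M e (n₁ := i + 1) (by omega)
        (Subsingleton.elim _ _)
      refine ⟨x2, ?_⟩
      have hff : ModuleCat.ofHom f = x • 𝟙 (ModuleCat.of R (R ⧸ I)) := by
        apply ModuleCat.hom_ext
        apply LinearMap.ext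
        intro a
        obtain ⟨r, rfl⟩ := Submodule.Quotient.mk_surjective _ a
        exact hfx r
      rw [← hx2, ← ext_smul_comp x x2]
      change _ = (Ext.mk₀ (ModuleCat.ofHom f)).comp x2 _
      rw [hff]
    have hfin : Module.Finite R (ModuleCat.of R (R ⧸ I)) :=
      inferInstanceAs (Module.Finite R (R ⧸ I))
    have := Submodule.eq_bot_of_le_smul_of_le_jacobson_bot (IsLocalRing.maximalIdeal R)
      (⊤ : Submodule R (Ext.{u} (ModuleCat.of R (R ⧸ I)) M i)) Module.Finite.fg_top
      (by
        intro e _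
        obtain ⟨e', rfl⟩ := key e
        exact Submodule.smul_mem_smul hxm trivial)
      (IsLocalRing.jacobson_eq_maximalIdeal ⊥ bot_ne_top).ge
    exact (Submodule.subsingleton_iff R).1 (subsingleton_of_bot_eq_top this.symm)
  · obtain ⟨f, g, hf, hfg, hg, hfx⟩ := quot_exact I J x hJ
    have hS := sc_se (A := ModuleCat.of R (R ⧸ J)) (B := ModuleCat.of R (R ⧸ I))
      (C := ModuleCat.of R (R ⧸ (I ⊔ Ideal.span {x}))) f g hfg hf hg
    intro i hi
    have h1 := ih _ hK i hi
    have h2 := ih _ (lt_of_le_of_ne hIJ hJI) i hi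
    refine subsingleton_of_forall_eq 0 fun e => ?_
    obtain ⟨x3, rfl⟩ := Ext.contravariant_sequence_exact₂ hS M e (Subsingleton.elim _ _)
    rw [Subsingleton.elim x3 0, Ext.comp_zero]

lemma subsingleton_of_ext_bot (M : ModuleCat.{u} R)
    (h : Subsingleton (Ext.{u} (ModuleCat.of R (R ⧸ (⊥ : Ideal R))) M 0)) : ∀ x : M, x = 0 := by
  intro x
  let φ : (R ⧸ (⊥ : Ideal R)) →ₗ[R] M := Submodule.liftQ _ (LinearMap.toSpanSingleton R M x)
    (by simp)
  have := Ext.homEquiv₀.symm.injective (Subsingleton.elim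
    (Ext.homEquiv₀.symm (ModuleCat.ofHom φ)) (Ext.homEquiv₀.symm 0))
  have h2 := congrArg (fun f => f.hom (Submodule.Quotient.mk (1 : R))) this
  have h3 : (1 : R) • x = 0 := h2
  simpa using h3

end Bass
end GG

namespace GG

section Vanish
open CategoryTheory Abelian

variable {R : Type u} [CommRing R]

lemma ext_zero_of_bij (T N : ModuleCat.{u} R) (x : R) (hT : ∀ t : T, x • t = 0)
    (hN : Function.Bijective (fun y : N => x • y)) (i : ℕ) : Subsingleton (Ext.{u} T N i) := by
  refine subsingleton_of_forall_eq 0 fun e => ?_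
  have h1 : x • e = 0 := by
    rw [← ext_smul_comp]
    have : x • 𝟙 T = 0 := by ext t; exact hT t
    rw [this, Ext.mk₀_zero, Ext.zero_comp]
  let φ : N ≃ₗ[R] N := LinearEquiv.ofBijective (LinearMap.lsmul R N x) hN
  have h2 : x • 𝟙 N = φ.toModuleIso.hom := by ext y; rfl
  rw [← ext_comp_smul, h2] at h1
  rw [← Ext.comp_mk₀_id e, ← φ.toModuleIso.hom_inv_id, ← Ext.mk₀_comp_mk₀,
    ← Ext.comp_assoc_of_third_deg_zero, h1, Ext.zero_comp]

lemma ext_factor [IsNoetherianRing R] (F : ModuleCat.{u} R) {ι : Type u} [DecidableEq ι]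
    (e : ι → (F →ₗ[R] F))
    (h : ∀ x, ∃ s : Finset ι, ∀ s', s ⊆ s' → (∑ p ∈ s', e p) x = x) (i : ℕ) :
    ∀ (T : ModuleCat.{u} R), Module.Finite R T → ∀ a : Ext.{u} T F i, ∃ s : Finset ι,
      a.comp (Ext.mk₀ (ModuleCat.ofHom (∑ p ∈ s, e p))) (add_zero i) = a := by
  induction i with
  | zero =>
    intro T hT a
    obtain ⟨φ, rfl⟩ := Ext.homEquiv₀.symm.surjective a
    obtain ⟨G, hG⟩ := hT.fg_top
    choose s hs using h
    refine ⟨G.biUnion (fun x => s (φ x)), ?_⟩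
    rw [Ext.homEquiv₀_symm_apply, Ext.mk₀_comp_mk₀]
    congr 1
    apply ModuleCat.hom_ext
    apply LinearMap.ext_on_range (v := ((↑) : G → T))
    · simpa using hG
    · rintro ⟨x, hx⟩
      exact hs (φ x) _ (Finset.subset_biUnion_of_mem (fun x => s (φ x)) hx)
  | succ n ih =>
    intro T hT a
    obtain ⟨N, _, _, _, _, f, surjf⟩ := Module.exists_finite_presentation R T
    let exac := LinearMap.shortExact_shortComplexKer surjf
    have : Projective f.shortComplexKer.X₂ := inferInstanceAs (Projective (ModuleCat.of R N))
    obtain ⟨a1, rfl⟩ := Ext.contravariant_sequence_exact₃ exac F a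
      (Ext.eq_zero_of_projective _) (n₀ := n) (by omega)
    obtain ⟨s, hs⟩ := ih _ (inferInstanceAs (Module.Finite R (LinearMap.ker f))) a1
    refine ⟨s, ?_⟩
    rw [Ext.comp_assoc_of_third_deg_zero, hs]

lemma ext_vanish_sum [IsNoetherianRing R] (F : ModuleCat.{u} R) {ι : Type u} [DecidableEq ι]
    (N : ι → ModuleCat.{u} R) (π : ∀ p, F →ₗ[R] N p) (j : ∀ p, N p →ₗ[R] F)
    (h : ∀ x, ∃ s : Finset ι, ∀ s', s ⊆ s' → (∑ p ∈ s', (j p).comp (π p)) x = x)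
    (T : ModuleCat.{u} R) [Module.Finite R T] (i : ℕ)
    (hT : ∀ p, Subsingleton (Ext.{u} T (N p) i)) : Subsingleton (Ext.{u} T F i) := by
  refine subsingleton_of_forall_eq 0 fun e => ?_
  obtain ⟨s, hs⟩ := ext_factor F (fun p => (j p).comp (π p)) h i T inferInstance e
  rw [← hs]
  clear hs
  induction s using Finset.induction_on with
  | empty => simp [ModuleCat.ofHom_zero]
  | insert p s hp ih =>
    rw [Finset.sum_insert hp, ModuleCat.ofHom_add, Ext.mk₀_add, Ext.comp_add, ih, add_zero,
      ModuleCat.ofHom_comp, ← Ext.mk₀_comp_mk₀, ← Ext.comp_assoc_of_third_deg_zero]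
    rw [Subsingleton.elim (e.comp (Ext.mk₀ (ModuleCat.ofHom (π p))) _) 0, Ext.zero_comp]

/-- Data of a long exact sequence split in short ones. -/
structure Split (K C : ℕ → ModuleCat.{u} R) where
  f : ∀ n, K n →ₗ[R] C n
  g : ∀ n, C n →ₗ[R] K (n + 1)
  inj : ∀ n, Function.Injective (f n)
  ex : ∀ n, Function.Exact (f n) (g n)
  surj : ∀ n, Function.Surjective (g n)

variable {K C : ℕ → ModuleCat.{u} R} (S : Split K C)

lemma Split.se (n : ℕ) : (sc (S.f n) (S.g n) (S.ex n)).ShortExact :=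
  sc_se _ _ _ (S.inj n) (S.surj n)

noncomputable def Split.om (S : Split K C) : ∀ n, Ext.{u} (K n) (K 0) n
  | 0 => Ext.mk₀ (𝟙 _)
  | n + 1 => (S.se n).extClass.comp (Split.om S n) (Nat.add_comm 1 n)

lemma Split.om_succ (n : ℕ) :
    S.om (n + 1) = (S.se n).extClass.comp (S.om n) (Nat.add_comm 1 n) := rfl

lemma Split.bij_step (T : ModuleCat.{u} R) (n : ℕ)
    (hv1 : ∀ i, Subsingleton (Ext.{u} T (C n) i)) (i i' : ℕ) (hi : i + 1 = i') :
    Function.Bijective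
        (fun e : Ext.{u} T (K (n + 1)) i => e.comp (S.se n).extClass hi) := by
  constructor
  · intro a b hab
    have hab' : (a + -b).comp (S.se n).extClass hi = 0 := by
      rw [Ext.add_comp, Ext.neg_comp, ← sub_eq_add_neg]; exact sub_eq_zero.2 hab
    obtain ⟨x2, hx2⟩ := Ext.covariant_sequence_exact₃ T (S.se n) (a + -b) hi hab'
    have := hv1 i
    have h0 : x2 = 0 := Subsingleton.elim (α := Ext.{u} T (C n) i) _ _
    rw [h0, Ext.zero_comp, ← sub_eq_add_neg] at hx2
    exact sub_eq_zero.1 hx2.symm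
  · intro b
    have := hv1 i'
    obtain ⟨x, hx⟩ := Ext.covariant_sequence_exact₁ T (S.se n) b
      (Subsingleton.elim (α := Ext.{u} T (C n) i') _ _) (n₀ := i) hi
    exact ⟨x, hx⟩

lemma Split.bij (T : ModuleCat.{u} R) (n : ℕ) :
    (∀ j < n, ∀ i, Subsingleton (Ext.{u} T (C j) i)) → ∀ (i N : ℕ) (hN : i + n = N),
    Function.Bijective (fun e : Ext.{u} T (K n) i => e.comp (S.om n) hN) := by
  induction n with
  | zero =>
    intro hv i N hN
    have hiN : i = N := hN
    subst hiN
    have : (fun e : Ext.{u} T (K 0) i => e.comp (S.om 0) hN) = id := by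
      funext e
      exact Ext.comp_mk₀_id e
    rw [this]
    exact Function.bijective_id
  | succ n ih =>
    intro hv i N hN
    have hb := ih (fun j hj => hv j (by omega)) (i + 1) N (by omega)
    have h1 := S.bij_step T n (hv n (by omega)) i (i + 1) rfl
    have h2 := hb.comp h1
    convert h2 using 2 with e
    rw [Function.comp, Ext.comp_assoc _ _ _ rfl (Nat.add_comm 1 n) (by omega), ← S.om_succ]

lemma Split.low (S : Split K C) (T : ModuleCat.{u} R) (n : ℕ)
    (hv : ∀ j ≤ n, ∀ i, Subsingleton (Ext.{u} T (C j) i)) : Subsingleton (Ext.{u} T (K 0) n) := by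
  have hb := S.bij T n (fun j hj => hv j hj.le) 0 n (by omega)
  refine subsingleton_of_forall_eq 0 fun e => ?_
  have : Subsingleton (Ext.{u} T (K n) 0) := by
    refine subsingleton_of_forall_eq 0 fun e => ?_
    obtain ⟨φ, rfl⟩ := Ext.homEquiv₀.symm.surjective e
    have := hv n le_rfl 0
    have h0 : φ ≫ ModuleCat.ofHom (S.f n) = 0 := Ext.homEquiv₀.symm.injective
      (Subsingleton.elim _ _)
    have : φ = 0 := by
      ext x
      apply S.inj n
      have := congrArg (fun f => f.hom x) h0
      simpa using this
    rw [this, Ext.homEquiv₀_symm_apply, Ext.mk₀_zero]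
  obtain ⟨a, ha⟩ := hb.2 e
  rw [← ha, Subsingleton.elim a 0]
  change (0 : Ext.{u} T (K n) 0).comp (S.om n) _ = 0
  rw [Ext.zero_comp]

end Vanish
end GG

namespace GG

section CousinFacts
open CategoryTheory Abelian

variable {R : Type u} [CommRing R]

section FS
variable (S : Set (PrimeSpectrum R)) (N : Type u) [AddCommGroup N] [Module R N]

noncomputable def fsProj (p : S) : finSupp R S N →ₗ[R] LocalizedModule p.1.asIdeal.primeCompl N :=
  (LinearMap.proj p).comp (finSupp R S N).subtype

open Classical in
noncomputable def fsIncl (p : S) : LocalizedModule p.1.asIdeal.primeCompl N →ₗ[R] finSupp R S N :=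
  (LinearMap.single R (fun p : S => LocalizedModule p.1.asIdeal.primeCompl N) p).codRestrict _ (by
    intro x
    refine (Set.finite_singleton p).subset ?_
    intro q hq
    by_contra h
    exact hq (by rw [LinearMap.single_apply, Pi.single_eq_of_ne h]))

lemma fs_sum (x : finSupp R S N) : ∃ s : Finset S, ∀ s', s ⊆ s' →
    (∑ p ∈ s', (fsIncl S N p).comp (fsProj S N p)) x = x := by
  classical
  refine ⟨x.2.toFinset, fun s' hs' => ?_⟩
  apply Subtype.ext
  funext q
  rw [LinearMap.sum_apply, Submodule.coe_sum, Finset.sum_apply]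
  have h1 : ∀ p, ((((fsIncl S N p).comp (fsProj S N p)) x : finSupp R S N) : locProd R S N) q =
      (Pi.single p (x.1 p) : locProd R S N) q := by
    intro p; rw [fsIncl]; simp [fsProj]; rfl
  simp only [h1]
  by_cases hq : q ∈ s'
  · rw [Finset.sum_eq_single q]
    · simp
    · intro p _ hpq; exact Pi.single_eq_of_ne (Ne.symm hpq) _
    · exact fun h => absurd hq h
  · have h0 : x.1 q = 0 := by
      by_contra h
      exact hq (hs' ((Set.Finite.mem_toFinset _).2 h))
    rw [h0]
    refine Finset.sum_eq_zero fun p hp => Pi.single_eq_of_ne ?_ _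
    rintro rfl; exact hq hp
end FS

lemma loc_bij (p : PrimeSpectrum R) (N : Type u) [AddCommGroup N] [Module R N] (x : R)
    (hx : x ∉ p.asIdeal) :
    Function.Bijective (fun y : LocalizedModule p.asIdeal.primeCompl N => x • y) := by
  have := IsLocalizedModule.map_units (LocalizedModule.mkLinearMap p.asIdeal.primeCompl N)
    (⟨x, hx⟩ : p.asIdeal.primeCompl)
  exact (Module.End.isUnit_iff _).1 this

lemma ext_finSupp_zero [IsNoetherianRing R] (S : Set (PrimeSpectrum R)) (N : ModuleCat.{u} R)
    (T : ModuleCat.{u} R) [Module.Finite R T]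
    (h : ∀ p ∈ S, ∃ x, x ∉ p.asIdeal ∧ ∀ t : T, x • t = 0) (i : ℕ) :
    Subsingleton (Ext.{u} T (ModuleCat.of R (finSupp R S N)) i) := by
  classical
  refine ext_vanish_sum _ (ι := S)
    (fun p => ModuleCat.of R (LocalizedModule p.1.asIdeal.primeCompl N))
    (fun p => fsProj S N p) (fun p => fsIncl S N p) (fs_sum S N) T i ?_
  intro p
  obtain ⟨x, hx, hT⟩ := h p.1 p.2
  exact ext_zero_of_bij T _ x hT (loc_bij p.1 N x hx) i

/-- The short exact sequences of an exact Cousin complex. -/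
noncomputable def cousinSplit (F : ℕ → Set (PrimeSpectrum R)) (M : ModuleCat.{u} R)
    (h1 : ∀ n, LinearMap.range (cousinTheta R F M n) ≤
      finSupp R (F n \ F (n + 1)) (cousinK R F M n))
    (h2 : Function.Injective (cousinTheta R F M 0))
    (h3 : ∀ n, LinearMap.ker (cousinD R F M n) =
    Submodule.comap (finSupp R (F n \ F (n + 1)) (cousinK R F M n)).subtype
      (LinearMap.range (cousinTheta R F M n))) :
    Split (cousinK R F M) (fun n => ModuleCat.of R (cousinC R F M n)) where
  f n := (cousinTheta R F M n).codRestrict _ (fun x => h1 n ⟨x, rfl⟩)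
  g n := Submodule.mkQ (Submodule.comap (finSupp R (F n \ F (n + 1)) (cousinK R F M n)).subtype
      (LinearMap.range (thetaFull R (F n \ F (n + 1)) (cousinK R F M n))))
  inj n := by
    have : Function.Injective (cousinTheta R F M n) := by
      cases n with
      | zero => exact h2
      | succ n =>
        have h := h3 n
        rw [injective_iff_map_eq_zero]
        intro a ha
        obtain ⟨y, rfl⟩ := Submodule.mkQ_surjective (Submodule.comap
          (finSupp R (F n \ F (n + 1)) (cousinK R F M n)).subtype
          (LinearMap.range (thetaFull R (F n \ F (n + 1)) (cousinK R F M n)))) a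
        have hy : y ∈ LinearMap.ker (cousinD R F M n) := ha
        rw [h] at hy
        exact (Submodule.Quotient.mk_eq_zero _).2 hy
    intro a b hab
    exact this (congrArg Subtype.val hab)
  ex n := by
    intro y
    constructor
    · intro h
      have h := (Submodule.Quotient.mk_eq_zero _).1 h
      obtain ⟨a, ha⟩ := h
      exact ⟨a, Subtype.ext ha⟩
    · rintro ⟨a, rfl⟩
      exact (Submodule.Quotient.mk_eq_zero _).2 ⟨a, rfl⟩
  surj n := Submodule.mkQ_surjective _

lemma fs_kill (S : Set (PrimeSpectrum R)) (N : Type u) [AddCommGroup N] [Module R N]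
    (p : PrimeSpectrum R)
    (y : finSupp R S N)
    (h : ∀ q : S, y.1 q ≠ 0 → ∃ s, s ∉ p.asIdeal ∧ s • y.1 q = 0) :
    ∃ s, s ∉ p.asIdeal ∧ s • y = 0 := by
  classical
  choose! s hs hsy using h
  have hfin : {q : S | y.1 q ≠ 0}.Finite := y.2
  refine ⟨∏ q ∈ hfin.toFinset, s q, ?_, ?_⟩
  · intro hmem
    obtain ⟨q, hq, hq'⟩ := (Ideal.IsPrime.prod_mem_iff).1 hmem
    exact hs q ((Set.Finite.mem_toFinset _).1 hq) hq'
  · apply Subtype.ext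
    funext q
    change (∏ q ∈ hfin.toFinset, s q) • y.1 q = 0
    by_cases hq : y.1 q = 0
    · rw [hq, smul_zero]
    · rw [← Finset.prod_erase_mul _ _ (a := q) (hfin.mem_toFinset.2 hq), mul_smul, hsy q hq, smul_zero]

lemma loc_kill (N : Type u) [AddCommGroup N] [Module R N] (p q : PrimeSpectrum R)
    (hqp : ¬ q ≤ p) (h : ∀ q' : PrimeSpectrum R, q' < q → ∀ a : N, ∃ v, v ∉ q'.asIdeal ∧ v • a = 0)
    (z : LocalizedModule q.asIdeal.primeCompl N) : ∃ s, s ∉ p.asIdeal ∧ s • z = 0 := by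
  obtain ⟨⟨a, t⟩, hz⟩ := IsLocalizedModule.surj q.asIdeal.primeCompl
    (LocalizedModule.mkLinearMap q.asIdeal.primeCompl N) z
  let U : Submonoid R := q.asIdeal.primeCompl ⊔ p.asIdeal.primeCompl
  by_cases hd : Disjoint ((LinearMap.ker (LinearMap.toSpanSingleton R N a) : Ideal R) : Set R) U
  · obtain ⟨q', hq', hle, hdis⟩ := Ideal.exists_le_prime_disjoint _ U hd
    have h1 : q' ≤ q.asIdeal := fun r hr => by
      by_contra hrq
      exact Set.disjoint_left.1 hdis hr ((le_sup_left : q.asIdeal.primeCompl ≤ U) hrq)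
    have h2 : q' ≤ p.asIdeal := fun r hr => by
      by_contra hrq
      exact Set.disjoint_left.1 hdis hr ((le_sup_right : p.asIdeal.primeCompl ≤ U) hrq)
    have h3 : (⟨q', hq'⟩ : PrimeSpectrum R) < q := by
      refine lt_of_le_of_ne h1 ?_
      rintro rfl
      exact hqp h2
    obtain ⟨v, hv, hva⟩ := h _ h3 a
    exact absurd (hle (by simpa using hva)) hv
  · obtain ⟨r, hr, hrU⟩ := Set.not_disjoint_iff.1 hd
    obtain ⟨w, hw, s, hs, rfl⟩ := Submonoid.mem_sup.1 hrU
    refine ⟨s, hs, ?_⟩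
    have ha : (w * s) • a = 0 := by simpa using hr
    apply (loc_bij q N (w * t) (fun h => (q.2.mem_or_mem h).elim hw t.2)).1
    simp only [smul_zero]
    have hz' : (t : R) • z = LocalizedModule.mkLinearMap q.asIdeal.primeCompl N a := hz
    calc (w * (t : R)) • s • z = (w * s) • ((t : R) • z) := by
          simp only [smul_smul]; congr 1; ring
      _ = 0 := by rw [hz', ← map_smul, ha, map_zero]

lemma cousin_torsion (F : ℕ → Set (PrimeSpectrum R)) (M : ModuleCat.{u} R)
    (h1 : ∀ n, LinearMap.range (cousinTheta R F M n) ≤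
      finSupp R (F n \ F (n + 1)) (cousinK R F M n))
    (hF0 : ∀ p, p ∉ F 0 → ∀ x : M, ∃ s, s ∉ p.asIdeal ∧ s • x = 0)
    (hF1 : ∀ n, ∀ q ∈ F n \ F (n + 1), ∀ q' < q, q' ∉ F n)
    (hF2 : ∀ n, ∀ q ∈ F n \ F (n + 1), ∀ p, q < p → p ∈ F (n + 1)) (n : ℕ) :
    ∀ p, p ∉ F n → ∀ x : cousinK R F M n, ∃ s, s ∉ p.asIdeal ∧ s • x = 0 := by
  induction n with
  | zero => exact hF0
  | succ n ih =>
    intro p hp x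
    obtain ⟨y, rfl⟩ := Submodule.mkQ_surjective (Submodule.comap
          (finSupp R (F n \ F (n + 1)) (cousinK R F M n)).subtype
          (LinearMap.range (thetaFull R (F n \ F (n + 1)) (cousinK R F M n)))) x
    have key : ∀ z : finSupp R (F n \ F (n + 1)) (cousinK R F M n),
        (∀ h : p ∈ F n \ F (n + 1), z.1 ⟨p, h⟩ = 0) → ∃ s, s ∉ p.asIdeal ∧ s • z = 0 := by
      intro z hz
      apply fs_kill
      rintro ⟨q, hq⟩ hzq
      refine loc_kill _ p q ?_ (fun q' hq' => ih q' (hF1 n q hq q' hq')) _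
      intro hqp
      rcases eq_or_lt_of_le hqp with rfl | hlt
      · exact hzq (hz hq)
      · exact hp (hF2 n q hq p hlt)
    have fin : ∀ s : R, s • y ∈ (Submodule.comap
          (finSupp R (F n \ F (n + 1)) (cousinK R F M n)).subtype
          (LinearMap.range (thetaFull R (F n \ F (n + 1)) (cousinK R F M n)))) →
        s ∉ p.asIdeal → ∃ s, s ∉ p.asIdeal ∧ s • (Submodule.mkQ (Submodule.comap
          (finSupp R (F n \ F (n + 1)) (cousinK R F M n)).subtype
          (LinearMap.range (thetaFull R (F n \ F (n + 1)) (cousinK R F M n)))) y) = 0 := by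
      intro s hs hsp
      refine ⟨s, hsp, ?_⟩
      rw [← map_smul]
      exact (Submodule.Quotient.mk_eq_zero _).2 hs
    by_cases hpm : p ∈ F n \ F (n + 1)
    · obtain ⟨⟨a, t⟩, hz⟩ := IsLocalizedModule.surj p.asIdeal.primeCompl
        (LocalizedModule.mkLinearMap p.asIdeal.primeCompl (cousinK R F M n)) (y.1 ⟨p, hpm⟩)
      obtain ⟨s, hs, hs0⟩ := key ((t : R) • y - ⟨cousinTheta R F M n a, h1 n ⟨a, rfl⟩⟩) (by
        intro h
        exact sub_eq_zero.2 hz)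
      refine fin (s * t) ?_ (fun h => (p.2.mem_or_mem h).elim hs t.2)
      refine ⟨s • a, ?_⟩
      rw [smul_sub, sub_eq_zero, smul_smul] at hs0
      rw [hs0, map_smul]
      rfl
    · obtain ⟨s, hs, hs0⟩ := key y (fun h => absurd h hpm)
      exact fin s (by rw [hs0]; exact zero_mem _) hs

end CousinFacts
end GG

namespace GG

section HF
open CategoryTheory Abelian

variable {R : Type u} [CommRing R]

lemma htM_lt (M : Type u) [AddCommGroup M] [Module R M] (d : ℕ)
    (hd : mdim R M = (d : WithBot ℕ∞)) (p q : PrimeSpectrum R) (hp : p ∈ Module.support R M)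
    (hpq : p < q) (n : ℕ) (hn : (n : ℕ∞) ≤ htM R M p) :
    q ∈ Module.support R M ∧ ((n + 1 : ℕ) : ℕ∞) ≤ htM R M q := by
  have hq : q ∈ Module.support R M := Module.mem_support_mono hpq.le hp
  refine ⟨hq, ?_⟩
  rw [htM, iSup_pos hp] at hn
  rw [htM, iSup_pos hq]
  have hlt : (⟨p, hp⟩ : ↥(Module.support R M)) < ⟨q, hq⟩ := hpq
  have hfin : Order.height (⟨p, hp⟩ : ↥(Module.support R M)) < ⊤ := by
    have := Order.height_le_krullDim (⟨p, hp⟩ : ↥(Module.support R M))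
    rw [show Order.krullDim ↥(Module.support R M) = (d : WithBot ℕ∞) from hd] at this
    have h2 : Order.height (⟨p, hp⟩ : ↥(Module.support R M)) ≤ (d : ℕ∞) := by exact_mod_cast this
    exact lt_of_le_of_lt h2 (ENat.natCast_lt_top d)
  have := Order.height_strictMono hlt hfin
  push_cast
  exact Order.add_one_le_of_lt (lt_of_le_of_lt hn this)

variable [IsLocalRing R]

lemma max_mem_support (M : Type u) [AddCommGroup M] [Module R M] (h0 : ∃ x : M, x ≠ 0) :
    IsLocalRing.closedPoint R ∈ Module.support R M := by
  have : Nontrivial M := ⟨⟨h0.choose, 0, h0.choose_spec⟩⟩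
  obtain ⟨p, hp⟩ := Module.nonempty_support_of_nontrivial (R := R) (M := M)
  exact Module.mem_support_mono (IsLocalRing.le_maximalIdeal p.2.ne_top) hp

lemma htM_max (M : Type u) [AddCommGroup M] [Module R M] (h0 : ∃ x : M, x ≠ 0) (d : ℕ)
    (hd : mdim R M = (d : WithBot ℕ∞)) : htM R M (IsLocalRing.closedPoint R) = d := by
  have hm := max_mem_support (R := R) M h0
  rw [htM, iSup_pos hm]
  let _ : OrderTop ↥(Module.support R M) :=
    { top := ⟨_, hm⟩, le_top := fun p => IsLocalRing.le_maximalIdeal p.1.2.ne_top }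
  have := Order.height_top_eq_krullDim (α := ↥(Module.support R M))
  rw [show Order.krullDim ↥(Module.support R M) = (d : WithBot ℕ∞) from hd] at this
  exact_mod_cast this

lemma hf_ne_max (M : Type u) [AddCommGroup M] [Module R M] (h0 : ∃ x : M, x ≠ 0) (d : ℕ)
    (hd : mdim R M = (d : WithBot ℕ∞)) (j : ℕ) (hj : j < d) (p : PrimeSpectrum R)
    (hp : p ∈ heightFiltration R M j \ heightFiltration R M (j + 1)) :
    p ≠ IsLocalRing.closedPoint R := by
  rintro rfl
  refine hp.2 ⟨hp.1.1, ?_⟩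
  rw [htM_max M h0 d hd]
  exact_mod_cast hj

lemma hf_top (M : Type u) [AddCommGroup M] [Module R M] (h0 : ∃ x : M, x ≠ 0) (d : ℕ)
    (hd : mdim R M = (d : WithBot ℕ∞)) (p : PrimeSpectrum R)
    (hp : p ∈ heightFiltration R M d) : p = IsLocalRing.closedPoint R := by
  by_contra hne
  have hlt : p < IsLocalRing.closedPoint R :=
    lt_of_le_of_ne (IsLocalRing.le_maximalIdeal p.2.ne_top) hne
  have := (htM_lt M d hd p _ hp.1 hlt d hp.2).2
  rw [htM_max M h0 d hd] at this
  have : d + 1 ≤ d := by exact_mod_cast this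
  omega

lemma hf_succ (M : Type u) [AddCommGroup M] [Module R M] (h0 : ∃ x : M, x ≠ 0) (d : ℕ)
    (hd : mdim R M = (d : WithBot ℕ∞)) (p : PrimeSpectrum R) :
    p ∉ heightFiltration R M (d + 1) := by
  intro hp
  have h1 : p = IsLocalRing.closedPoint R := hf_top M h0 d hd p
    ⟨hp.1, le_trans (by exact_mod_cast Nat.le_succ d) hp.2⟩
  subst h1
  have := hp.2
  rw [htM_max M h0 d hd] at this
  have : d + 1 ≤ d := by exact_mod_cast this
  omega

lemma hf_torsion (M : ModuleCat.{u} R) [Module.Finite R M] (d : ℕ)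
    (hd : mdim R M = (d : WithBot ℕ∞))
    (h1 : ∀ n, LinearMap.range (cousinTheta R (heightFiltration R M) M n) ≤
      finSupp R (heightFiltration R M n \ heightFiltration R M (n + 1))
        (cousinK R (heightFiltration R M) M n)) (n : ℕ) (p : PrimeSpectrum R)
    (hp : p ∉ heightFiltration R M n) (x : cousinK R (heightFiltration R M) M n) :
    ∃ s, s ∉ p.asIdeal ∧ s • x = 0 := by
  refine cousin_torsion (heightFiltration R M) M h1 ?_ ?_ ?_ n p hp x
  · intro p hp x
    have : p ∉ Module.support R M := fun h => hp ⟨h, by simp⟩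
    exact Module.notMem_support_iff'.1 this x
  · intro n q hq q' hq' hmem
    exact hq.2 (htM_lt M d hd q' q hmem.1 hq' n hmem.2)
  · intro n q hq p hqp
    exact htM_lt M d hd q p hq.1.1 hqp n hq.1.2

lemma K_succ_zero (M : ModuleCat.{u} R) [Module.Finite R M] (h0 : ∃ x : M, x ≠ 0) (d : ℕ)
    (hd : mdim R M = (d : WithBot ℕ∞))
    (h1 : ∀ n, LinearMap.range (cousinTheta R (heightFiltration R M) M n) ≤
      finSupp R (heightFiltration R M n \ heightFiltration R M (n + 1))
        (cousinK R (heightFiltration R M) M n))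
    (x : cousinK R (heightFiltration R M) M (d + 1)) : x = 0 := by
  obtain ⟨s, hs, hsx⟩ := hf_torsion M d hd h1 (d + 1) (IsLocalRing.closedPoint R)
    (hf_succ M h0 d hd _) x
  have hu : IsUnit s := by
    by_contra h
    exact hs ((IsLocalRing.mem_maximalIdeal s).2 h)
  exact (hu.smul_eq_zero).1 hsx

lemma K_torsion [IsNoetherianRing R] (M : ModuleCat.{u} R) [Module.Finite R M]
    (h0 : ∃ x : M, x ≠ 0) (d : ℕ)
    (hd : mdim R M = (d : WithBot ℕ∞))
    (h1 : ∀ n, LinearMap.range (cousinTheta R (heightFiltration R M) M n) ≤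
      finSupp R (heightFiltration R M n \ heightFiltration R M (n + 1))
        (cousinK R (heightFiltration R M) M n))
    (x : cousinK R (heightFiltration R M) M d) :
    ∃ t : ℕ, ∀ r ∈ IsLocalRing.maximalIdeal R ^ t, r • x = 0 := by
  let A : Ideal R := LinearMap.ker (LinearMap.toSpanSingleton R _ x)
  have hA : ∀ r, r ∈ A ↔ r • x = 0 := fun r => Iff.rfl
  have : IsLocalRing.maximalIdeal R ≤ A.radical := by
    rw [Ideal.radical_eq_sInf]
    refine le_sInf ?_
    rintro P ⟨hAP, hP⟩
    by_contra hle
    obtain ⟨s, hs, hsx⟩ := hf_torsion M d hd h1 d ⟨P, hP⟩ (fun hmem => hle (by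
      have := congrArg PrimeSpectrum.asIdeal (hf_top M h0 d hd _ hmem)
      exact this.ge)) x
    exact hs (hAP ((hA s).2 hsx))
  obtain ⟨t, ht⟩ := Ideal.exists_pow_le_of_le_radical_of_fg this (IsNoetherian.noetherian _)
  exact ⟨t, fun r hr => (hA r).1 (ht hr)⟩

/-- An element of the maximal ideal outside of `p`, killing `T`. -/
lemma kill_outside (t : ℕ) (p : PrimeSpectrum R) (hp : p ≠ IsLocalRing.closedPoint R) :
    ∃ x ∈ IsLocalRing.maximalIdeal R ^ t, x ∉ p.asIdeal := by
  by_contra! h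
  have h1 : IsLocalRing.maximalIdeal R ≤ p.asIdeal := p.2.le_of_pow_le h
  exact hp (PrimeSpectrum.ext (le_antisymm (IsLocalRing.le_maximalIdeal p.2.ne_top) h1))

lemma ext_C_zero [IsNoetherianRing R] (M : ModuleCat.{u} R)
    (h0 : ∃ x : M, x ≠ 0) (d : ℕ) (hd : mdim R M = (d : WithBot ℕ∞)) (T : ModuleCat.{u} R)
    [Module.Finite R T] (t : ℕ) (hT : ∀ r ∈ IsLocalRing.maximalIdeal R ^ t, ∀ y : T, r • y = 0)
    (j : ℕ) (hj : j < d) (i : ℕ) :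
    Subsingleton (Ext.{u} T (ModuleCat.of R (cousinC R (heightFiltration R M) M j)) i) := by
  refine ext_finSupp_zero _ _ T (fun p hp => ?_) i
  obtain ⟨x, hx, hxp⟩ := kill_outside t p (hf_ne_max M h0 d hd j hj p hp)
  exact ⟨x, hxp, hT x hx⟩

lemma gi_equiv {N N' : Type u} [AddCommGroup N] [Module R N] [AddCommGroup N'] [Module R N']
    (e : N ≃ₗ[R] N') (h : IsGorensteinInjective R N) : IsGorensteinInjective R N' := by
  obtain ⟨X, d, h1, h2, h3, ⟨f⟩⟩ := h
  exact ⟨X, d, h1, h2, h3, ⟨e.symm.trans f⟩⟩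

end HF
end GG

namespace GG

section OpHom
open CategoryTheory

variable {R : Type u} [CommRing R] (L : ChainComplex (ModuleCat.{u} R)ᵒᵖ ℕ) (n : ℕ)

/-- inclusion of cocycles -/
noncomputable def opI : (L.opcycles n).unop →ₗ[R] (L.X n).unop := (L.pOpcycles n).unop.hom

/-- projection to cohomology -/
noncomputable def opP : (L.opcycles n).unop →ₗ[R] (L.homology n).unop := (L.homologyι n).unop.hom

lemma opI_inj : Function.Injective (opI L n) := by
  have : Mono (L.pOpcycles n).unop := inferInstance
  exact (ModuleCat.mono_iff_injective _).1 this

lemma opP_surj : Function.Surjective (opP L n) := by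
  have : Epi (L.homologyι n).unop := inferInstance
  exact (ModuleCat.epi_iff_surjective _).1 this

lemma opI_exact (f : (L.X n).unop) (hf : (L.d (n + 1) n).unop.hom f = 0) : ∃ z, opI L n z = f := by
  have h := ShortComplex.exact_of_g_is_cokernel
    (ShortComplex.mk (L.d (n + 1) n) (L.pOpcycles n) (by simp)) (L.opcyclesIsCokernel (n + 1) n (by simp))
  have h2 := h.unop
  rw [ShortComplex.moduleCat_exact_iff] at h2
  exact h2 f hf

lemma opI_d (z) : (L.d (n + 1) n).unop.hom (opI L n z) = 0 := by
  have : (L.pOpcycles n).unop ≫ (L.d (n + 1) n).unop = 0 := by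
    rw [← unop_comp]; simp
  exact congrArg (fun φ => φ.hom z) this

lemma opP_eq_zero (p : ℕ) (hp : (ComplexShape.down ℕ).next n = p) (z) :
    opP L n z = 0 ↔ ∃ g : (L.X p).unop, (L.d n p).unop.hom g = opI L n z := by
  have h := ShortComplex.exact_of_f_is_kernel
    (ShortComplex.mk (L.homologyι n) (L.fromOpcycles n p) (by simp)) (L.homologyIsKernel n p hp)
  have h2 := h.unop
  rw [ShortComplex.moduleCat_exact_iff] at h2
  have h3 : ∀ g, opI L n ((L.fromOpcycles n p).unop.hom g) = (L.d n p).unop.hom g := fun g => by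
    have : (L.fromOpcycles n p).unop ≫ (L.pOpcycles n).unop = (L.d n p).unop := by
      rw [← unop_comp]; simp
    exact congrArg (fun φ => φ.hom g) this
  constructor
  · intro hz
    obtain ⟨g, hg⟩ := h2 z hz
    exact ⟨g, (h3 g).symm.trans (congrArg (opI L n) hg)⟩
  · rintro ⟨g, hg⟩
    rw [← h3] at hg
    rw [← opI_inj L n hg]
    have : (L.fromOpcycles n p).unop ≫ (L.homologyι n).unop = 0 := by
      rw [← unop_comp]; simp
    exact congrArg (fun φ => φ.hom g) this

lemma op_nat {L L' : ChainComplex (ModuleCat.{u} R)ᵒᵖ ℕ} (φ : L ⟶ L') (n : ℕ) (z : (L'.opcycles n).unop) :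
    ∃ z' : (L.opcycles n).unop, opI L n z' = (φ.f n).unop.hom (opI L' n z) ∧
      opP L n z' = (HomologicalComplex.homologyMap φ n).unop.hom (opP L' n z) := by
  refine ⟨(HomologicalComplex.opcyclesMap φ n).unop.hom z, ?_, ?_⟩
  · have : (HomologicalComplex.opcyclesMap φ n).unop ≫ (L.pOpcycles n).unop
      = (L'.pOpcycles n).unop ≫ (φ.f n).unop := by
      rw [← unop_comp, ← unop_comp]; simp
    exact congrArg (fun φ => φ.hom z) this
  · have : (HomologicalComplex.opcyclesMap φ n).unop ≫ (L.homologyι n).unop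
      = (L'.homologyι n).unop ≫ (HomologicalComplex.homologyMap φ n).unop := by
      rw [← unop_comp, ← unop_comp]; simp
    exact congrArg (fun φ => φ.hom z) this

end OpHom
end GG

namespace GG

section ExtCmp
open CategoryTheory

variable {R : Type u} [CommRing R]

/-- The Hom complex in the opposite category. -/
noncomputable abbrev LC {X : ModuleCat.{u} R} (P : ProjectiveResolution X) (Y : ModuleCat.{u} R) :
    ChainComplex (ModuleCat.{u} R)ᵒᵖ ℕ :=
  (((linearYoneda R (ModuleCat.{u} R)).obj Y).rightOp.mapHomologicalComplex _).obj P.complex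

lemma smul_extMk {X : ModuleCat.{u} R} (P : ProjectiveResolution X) {Y : ModuleCat.{u} R} (n : ℕ)
    (r : R) (f : P.complex.X n ⟶ Y) (h : P.complex.d (n + 1) n ≫ f = 0)
    (h' : P.complex.d (n + 1) n ≫ (r • f) = 0) :
    P.extMk (r • f) (n + 1) rfl h' = r • (P.extMk f (n + 1) rfl h : Abelian.Ext.{u} X Y n) := by
  have := P.extMk_comp_mk₀ f (n+1) rfl h (r • 𝟙 Y)
  have h2 : f ≫ (r • 𝟙 Y) = r • f := by simp
  simp only [h2] at this
  rw [← this, Abelian.Ext.mk₀_smul, Abelian.Ext.comp_smul, Abelian.Ext.comp_mk₀_id]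

/-- The cocycle -/
noncomputable def coc {X : ModuleCat.{u} R} (P : ProjectiveResolution X) (Y : ModuleCat.{u} R)
    (n : ℕ) (z : ((LC P Y).opcycles n).unop) : P.complex.X n ⟶ Y := opI (LC P Y) n z

lemma coc_d {X : ModuleCat.{u} R} (P : ProjectiveResolution X) (Y : ModuleCat.{u} R)
    (n : ℕ) (z : ((LC P Y).opcycles n).unop) : P.complex.d (n + 1) n ≫ coc P Y n z = 0 :=
  opI_d (LC P Y) n z

noncomputable def cmpZ {X : ModuleCat.{u} R} (P : ProjectiveResolution X) (Y : ModuleCat.{u} R)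
    (n : ℕ) : ((LC P Y).opcycles n).unop →ₗ[R] Abelian.Ext.{u} X Y n where
  toFun z := P.extMk (coc P Y n z) (n + 1) rfl (coc_d P Y n z)
  map_add' z w := by
    rw [P.add_extMk]
    congr 1
    exact (opI (LC P Y) n).map_add z w
  map_smul' r z := by
    have h : coc P Y n (r • z) = r • coc P Y n z := (opI (LC P Y) n).map_smul r z
    have h2 := coc_d P Y n (r • z)
    rw [h] at h2
    refine Eq.trans ?_ (smul_extMk P n r (coc P Y n z) (coc_d P Y n z) h2)
    congr 1

lemma cmpZ_surj {X : ModuleCat.{u} R} (P : ProjectiveResolution X) (Y : ModuleCat.{u} R)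
    (n : ℕ) : Function.Surjective (cmpZ P Y n) := fun e => by
  obtain ⟨f, hf, rfl⟩ := P.extMk_surjective e (n + 1) rfl
  obtain ⟨z, hz⟩ := opI_exact (LC P Y) n f hf
  have hz : coc P Y n z = f := hz
  subst hz
  exact ⟨z, rfl⟩

lemma extMk_zero_iff {X Y : ModuleCat.{u} R} (P : ProjectiveResolution X) (f : P.complex.X 0 ⟶ Y)
    (hf : P.complex.d 1 0 ≫ f = 0) :
    (P.extMk f 1 rfl hf : Abelian.Ext.{u} X Y 0) = 0 ↔ f = 0 := by
  simp only [← P.extEquivCohomologyClass.apply_eq_iff_eq,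
    ProjectiveResolution.extEquivCohomologyClass_extMk,
    ProjectiveResolution.extEquivCohomologyClass_zero,
    CochainComplex.HomComplex.CohomologyClass.mk_eq_zero_iff]
  rw [CochainComplex.HomComplex.Cocycle.toSingleMk_mem_coboundaries_iff _ _ _ _ _ 1 (by simp)]
  have hz : Limits.IsZero (P.cochainComplex.X 1) := P.cochainComplex.isZero_of_isStrictlyLE 0 1 (by simp)
  constructor
  · rintro ⟨g, hg⟩
    rw [hz.eq_zero_of_src g, Limits.comp_zero] at hg
    rw [← cancel_epi (P.cochainComplexXIso (-(0:ℕ)) 0 rfl).hom, Limits.comp_zero]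
    exact hg.symm
  · rintro rfl
    exact ⟨0, by simp⟩

lemma cmpZ_zero_iff {X : ModuleCat.{u} R} (P : ProjectiveResolution X) (Y : ModuleCat.{u} R)
    (n : ℕ) (z : ((LC P Y).opcycles n).unop) : cmpZ P Y n z = 0 ↔ opP (LC P Y) n z = 0 := by
  cases n with
  | zero =>
    rw [opP_eq_zero (LC P Y) 0 0 (by simp)]
    refine (extMk_zero_iff P _ (coc_d P Y 0 z)).trans ?_
    have hd : (LC P Y).d 0 0 = 0 := (LC P Y).shape _ _ (by simp)
    rw [hd]
    constructor
    · intro h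
      exact ⟨0, h.symm⟩
    · rintro ⟨g, hg⟩
      exact hg.symm
  | succ n =>
    rw [opP_eq_zero (LC P Y) (n + 1) n (by simp)]
    exact P.extMk_eq_zero_iff _ _ rfl (coc_d P Y (n + 1) z) n rfl

/-- The comparison linear equivalence, at the level of a projective resolution. -/
lemma cmp_exists {X : ModuleCat.{u} R} (P : ProjectiveResolution X) (Y : ModuleCat.{u} R)
    (n : ℕ) : ∃ e : ((LC P Y).homology n).unop ≃ₗ[R] Abelian.Ext.{u} X Y n,
      ∀ z, e (opP (LC P Y) n z) = cmpZ P Y n z := by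
  have hker : LinearMap.ker (opP (LC P Y) n) = LinearMap.ker (cmpZ P Y n) := by
    ext z
    exact (cmpZ_zero_iff P Y n z).symm
  refine ⟨((opP (LC P Y) n).quotKerEquivOfSurjective (opP_surj _ n)).symm.trans
    ((Submodule.quotEquivOfEq _ _ hker).trans
      ((cmpZ P Y n).quotKerEquivOfSurjective (cmpZ_surj P Y n))), fun z => ?_⟩
  have : ((opP (LC P Y) n).quotKerEquivOfSurjective (opP_surj _ n)).symm (opP (LC P Y) n z)
      = Submodule.Quotient.mk z := by
    rw [LinearEquiv.symm_apply_eq]; rfl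
  simp only [LinearEquiv.trans_apply, this]
  rfl

noncomputable def cmp {X : ModuleCat.{u} R} (P : ProjectiveResolution X) (Y : ModuleCat.{u} R)
    (n : ℕ) := (cmp_exists P Y n).choose

lemma cmp_opP {X : ModuleCat.{u} R} (P : ProjectiveResolution X) (Y : ModuleCat.{u} R)
    (n : ℕ) (z) : cmp P Y n (opP (LC P Y) n z) = cmpZ P Y n z := (cmp_exists P Y n).choose_spec z

lemma cmp_nat {X X' : ModuleCat.{u} R} (P : ProjectiveResolution X) (P' : ProjectiveResolution X')
    (Y : ModuleCat.{u} R) (n : ℕ) (g : X ⟶ X') (φ : P.Hom P' g) (h : ((LC P' Y).homology n).unop) :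
    cmp P Y n ((HomologicalComplex.homologyMap
      ((((linearYoneda R (ModuleCat.{u} R)).obj Y).rightOp.mapHomologicalComplex _).map φ.hom)
        n).unop.hom h) = (Abelian.Ext.mk₀ g).comp (cmp P' Y n h) (zero_add n) := by
  obtain ⟨z, rfl⟩ := opP_surj _ n h
  obtain ⟨z', h1, h2⟩ := op_nat
    ((((linearYoneda R (ModuleCat.{u} R)).obj Y).rightOp.mapHomologicalComplex _).map φ.hom) n z
  rw [cmp_opP, ← h2, cmp_opP]
  refine Eq.trans ?_ (ProjectiveResolution.mk₀_comp_extMk (coc P' Y n z) (n + 1) rfl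
    (coc_d P' Y n z) φ).symm
  change P.extMk (coc P Y n z') (n + 1) rfl (coc_d P Y n z') = _
  congr 1

/-- comparison of the two definitions of Ext -/
noncomputable def oldExt (X Y : ModuleCat.{u} R) (n : ℕ) :
    ((_root_.Ext R (ModuleCat.{u} R) n).obj (Opposite.op X)).obj Y ≃ₗ[R] Abelian.Ext.{u} X Y n :=
  (((projectiveResolution X).isoLeftDerivedObj
    ((linearYoneda R (ModuleCat.{u} R)).obj Y).rightOp n).unop.symm.toLinearEquiv).trans
    (cmp (projectiveResolution X) Y n)

lemma oldExt_nat {X X' : ModuleCat.{u} R} (Y : ModuleCat.{u} R) (n : ℕ) (g : X ⟶ X')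
    (h : ((_root_.Ext R (ModuleCat.{u} R) n).obj (Opposite.op X')).obj Y) :
    oldExt X Y n ((((_root_.Ext R (ModuleCat.{u} R) n).map g.op).app Y).hom h) =
      (Abelian.Ext.mk₀ g).comp (oldExt X' Y n h) (zero_add n) := by
  let P := projectiveResolution X
  let P' := projectiveResolution X'
  let φ : P.Hom P' g := ⟨ProjectiveResolution.lift g P P', by
    rw [← HomologicalComplex.comp_f, ProjectiveResolution.lift_commutes, HomologicalComplex.comp_f]⟩
  refine Eq.trans ?_ (cmp_nat P P' Y n g φ _)
  have := Functor.leftDerived_map_eq (((linearYoneda R (ModuleCat.{u} R)).obj Y).rightOp) n g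
    (P := P) (Q := P') φ.hom (by simp [φ])
  have h2 := congrArg (fun ψ => ψ.unop.hom h) this
  change ((((_root_.Ext R (ModuleCat.{u} R) n).map g.op).app Y).hom h) = _ at h2
  rw [h2]
  refine congrArg (cmp P Y n) ?_
  have h3 := (P.isoLeftDerivedObj
    ((linearYoneda R (ModuleCat.{u} R)).obj Y).rightOp n).inv_hom_id
  have h4 : ∀ y, (P.isoLeftDerivedObj
    ((linearYoneda R (ModuleCat.{u} R)).obj Y).rightOp n).inv.unop.hom ((P.isoLeftDerivedObj
    ((linearYoneda R (ModuleCat.{u} R)).obj Y).rightOp n).hom.unop.hom y) = y := fun y =>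
    congrArg (fun ψ => ψ.unop.hom y) h3
  exact h4 _

end ExtCmp
end GG

namespace GG

section LocCoh
open CategoryTheory Limits

variable {R : Type u} [CommRing R]

/-- the map to K -/
lemma exists_psi (T K M : ModuleCat.{u} R) (d : ℕ) (om : Abelian.Ext.{u} K M d)
    (hb : Function.Bijective (fun e : Abelian.Ext.{u} T K 0 => e.comp om (zero_add d))) :
    ∃ ψ : (T ⟶ K) ≃ₗ[R] Abelian.Ext.{u} T M d,
      ∀ h, ψ h = (Abelian.Ext.mk₀ h).comp om (zero_add d) := by
  have hb2 : Function.Bijective (fun h : T ⟶ K => (Abelian.Ext.mk₀ h).comp om (zero_add d)) := by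
    have := hb.comp (Abelian.Ext.homEquiv₀ (X := T) (Y := K)).symm.bijective
    convert this using 2 with h
    simp [Abelian.Ext.homEquiv₀_symm_apply]
  exact ⟨LinearEquiv.ofBijective
    { toFun := fun h => (Abelian.Ext.mk₀ h).comp om (zero_add d)
      map_add' := fun a b => by rw [Abelian.Ext.mk₀_add, Abelian.Ext.add_comp]
      map_smul' := fun r a => by
        rw [Abelian.Ext.mk₀_smul, Abelian.Ext.smul_comp]; rfl } hb2, fun h => rfl⟩

theorem locCoh_equiv (J : Ideal R) (K M : ModuleCat.{u} R) (d : ℕ) (om : Abelian.Ext.{u} K M d)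
    (hb : ∀ t : ℕ, Function.Bijective
      (fun e : Abelian.Ext.{u} (ModuleCat.of R (R ⧸ J ^ t)) K 0 => e.comp om (zero_add d)))
    (hK : ∀ x : K, ∃ t : ℕ, ∀ r ∈ J ^ t, r • x = 0) :
    Nonempty ((localCohomology J d).obj M ≃ₗ[R] K) := by
  choose ψ hψ using fun t => exists_psi (ModuleCat.of R (R ⧸ J ^ t)) K M d om (hb t)
  let φ : ∀ t : ℕ, ((_root_.Ext R (ModuleCat.{u} R) d).obj (Opposite.op
      (ModuleCat.of R (R ⧸ J ^ t)))).obj M →ₗ[R] K := fun t =>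
    { toFun := fun e => ((ψ t).symm (oldExt _ M d e)).hom (Submodule.Quotient.mk (1 : R))
      map_add' := fun a b => by rw [map_add, map_add]; rfl
      map_smul' := fun r a => by rw [map_smul, map_smul]; rfl }
  have φ_inj : ∀ t, Function.Injective (φ t) := by
    intro t a b hab
    apply (oldExt _ M d).injective
    apply (ψ t).symm.injective
    apply ModuleCat.hom_ext
    refine Submodule.linearMap_qext _ ?_
    ext
    exact hab
  have φ_surj : ∀ t (x : K), (∀ r ∈ J ^ t, r • x = 0) → ∃ e, φ t e = x := by
    intro t x hx
    let h : (R ⧸ J ^ t) →ₗ[R] K := Submodule.liftQ (J ^ t) (LinearMap.toSpanSingleton R K x)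
      (fun r hr => hx r hr)
    refine ⟨(oldExt _ M d).symm (ψ t (ModuleCat.ofHom h)), ?_⟩
    change ((ψ t).symm (oldExt _ M d _)).hom _ = x
    rw [LinearEquiv.apply_symm_apply, LinearEquiv.symm_apply_apply]
    change (1 : R) • x = x
    rw [one_smul]
  have φ_nat : ∀ (t s : ℕ) (g : ModuleCat.of R (R ⧸ J ^ t) ⟶ ModuleCat.of R (R ⧸ J ^ s))
      (_ : g.hom (Submodule.Quotient.mk (1 : R)) = Submodule.Quotient.mk (1 : R)) (e),
      φ t ((((_root_.Ext R (ModuleCat.{u} R) d).map g.op).app M).hom e) = φ s e := by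
    intro t s g hg e
    change ((ψ _).symm (oldExt _ M d _)).hom _ = ((ψ _).symm (oldExt _ M d e)).hom _
    rw [oldExt_nat]
    obtain ⟨h, hh⟩ := (ψ s).surjective (oldExt _ M d e)
    rw [← hh, LinearEquiv.symm_apply_apply]
    have : (Abelian.Ext.mk₀ g).comp (ψ s h) (zero_add d) = ψ t (g ≫ h) := by
      rw [hψ, hψ, ← Abelian.Ext.mk₀_comp_mk₀, Abelian.Ext.comp_assoc (h₁₂ := zero_add 0) (h₂₃ := zero_add d)]
      omega
    rw [this, LinearEquiv.symm_apply_apply]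
    change h.hom (g.hom _) = _
    rw [hg]
  let D := localCohomology.diagram (localCohomology.idealPowersDiagram J) d
  let F := D ⋙ (evaluation _ _).obj M
  let c : Cocone F :=
    { pt := K
      ι := { app := fun t => ModuleCat.ofHom (φ t.unop.unop)
             naturality := by
              intro s t f
              apply ModuleCat.hom_ext
              ext e
              exact φ_nat t.unop.unop s.unop.unop
                ((localCohomology.ringModIdeals (localCohomology.idealPowersDiagram J)).map f.unop)
                rfl e } }
  have hc := isColimitOfPreserves ((evaluation _ _).obj M) (colimit.isColimit D)
  have : PreservesFilteredColimitsOfSize.{0, 0} (forget (ModuleCat.{u} R)) :=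
    preservesFilteredColimitsOfSize_shrink.{0, u, 0, u} (forget (ModuleCat.{u} R))
  have : IsFiltered (ℕᵒᵖ)ᵒᵖ := inferInstance
  have : PreservesColimit F (forget (ModuleCat.{u} R)) := inferInstance
  let q := hc.desc c
  have hq : ∀ t e, q.hom ((((evaluation _ _).obj M).mapCocone (colimit.cocone D)).ι.app t e) =
    φ t.unop.unop e := fun t e => congrArg (fun ψ => ψ.hom e) (hc.fac c t)
  refine ⟨LinearEquiv.ofBijective q.hom ⟨?_, ?_⟩⟩
  · rw [injective_iff_map_eq_zero]
    intro a ha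
    obtain ⟨t, e, rfl⟩ := Concrete.isColimit_exists_rep F hc a
    have h2 : φ t.unop.unop e = 0 := (hq t e).symm.trans ha
    have : e = 0 := φ_inj t.unop.unop (h2.trans (map_zero _).symm)
    rw [this]
    exact map_zero _
  · intro x
    obtain ⟨t, ht⟩ := hK x
    obtain ⟨e, he⟩ := φ_surj t x ht
    exact ⟨_, (hq (Opposite.op (Opposite.op t)) e).trans he⟩

end LocCoh
end GG

namespace GG

section GorInj
open CategoryTheory Abelian

variable {R : Type u} [CommRing R]

lemma inj_retract (N X : ModuleCat.{u} R) (hX : Module.Injective R X) (i : N →ₗ[R] X)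
    (r : X →ₗ[R] N) (h : ∀ x, r (i x) = x) : Module.Injective R N := by
  constructor
  intro A B _ _ _ _ f hf g
  obtain ⟨k, hk⟩ := hX.out f hf (i.comp g)
  exact ⟨r.comp k, fun x => by
    rw [LinearMap.comp_apply, hk, LinearMap.comp_apply, h]⟩

lemma gi_lift (X : ℤ → ModuleCat.{u} R) (d : ∀ n : ℤ, X n →ₗ[R] X (n + 1))
    (h1 : ∀ n, Module.Injective R (X n))
    (h2 : ∀ n, LinearMap.range (d n) = LinearMap.ker (d (n + 1)))
    (h3 : ∀ (I : ModuleCat.{u} R), Module.Injective R I →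
      ∀ (n : ℤ) (φ : I →ₗ[R] X (n + 1)), (d (n + 1)).comp φ = 0 →
        ∃ ψ : I →ₗ[R] X n, (d n).comp ψ = φ) (k : ℕ) :
    ∀ (W : ModuleCat.{u} R) (_ : HasInjectiveDimensionLT W (k + 1))
      (n : ℤ) (φ : W →ₗ[R] X (n + 1)), (d (n + 1)).comp φ = 0 →
        ∃ ψ : W →ₗ[R] X n, (d n).comp ψ = φ := by
  induction k with
  | zero =>
    intro W hW
    exact h3 W ((Module.injective_iff_injective_object R W).2
      (injective_iff_hasInjectiveDimensionLT_one.2 hW))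
  | succ k ih =>
    intro W hW n φ hφ
    obtain ⟨J, W', i, π, hJ, hi, hex, hπ⟩ := exists_inj_coker W
    have hJ' : Injective J := Module.injective_object_of_injective_module R J
    have hS := sc_se i π hex hi hπ
    have hW' : HasInjectiveDimensionLT W' (k + 1) := (hS.hasInjectiveDimensionLT_X₃_iff k hJ').2 hW
    obtain ⟨Φ, hΦ⟩ := (h1 (n + 1)).out i hi φ
    have hdd : ∀ m x, d (m + 1) (d m x) = 0 := fun m x => by
      have : d m x ∈ LinearMap.ker (d (m + 1)) := by rw [← h2]; exact ⟨x, rfl⟩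
      exact this
    have hker : LinearMap.ker π ≤ LinearMap.ker ((d (n + 1)).comp Φ) := by
      intro y hy
      obtain ⟨w, rfl⟩ := (hex y).1 hy
      change d (n + 1) (Φ (i w)) = 0
      rw [hΦ]
      exact LinearMap.congr_fun hφ w
    let θ : W' →ₗ[R] X (n + 1 + 1) :=
      ((LinearMap.ker π).liftQ _ hker).comp (π.quotKerEquivOfSurjective hπ).symm.toLinearMap
    have hθ : ∀ y, θ (π y) = d (n + 1) (Φ y) := by
      intro y
      have : (π.quotKerEquivOfSurjective hπ).symm (π y) = Submodule.Quotient.mk y := by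
        rw [LinearEquiv.symm_apply_eq]; rfl
      change (LinearMap.ker π).liftQ _ hker ((π.quotKerEquivOfSurjective hπ).symm (π y)) = _
      rw [this]; rfl
    obtain ⟨h, hh⟩ := ih W' hW' (n + 1) θ (by
      ext w
      obtain ⟨y, rfl⟩ := hπ w
      change d (n + 1 + 1) (θ (π y)) = 0
      rw [hθ, hdd])
    obtain ⟨ψ, hψ⟩ := h3 J hJ n (Φ - h.comp π) (by
      ext y
      change d (n + 1) (Φ y - h (π y)) = 0
      rw [map_sub, sub_eq_zero, ← hθ]
      exact (LinearMap.congr_fun hh (π y)).symm)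
    refine ⟨ψ.comp i, ?_⟩
    ext w
    have := LinearMap.congr_fun hψ (i w)
    change d n (ψ (i w)) = φ w
    refine this.trans ?_
    change Φ (i w) - h (π (i w)) = _
    rw [hΦ, (hex (i w)).2 ⟨w, rfl⟩, map_zero, sub_zero]

lemma gi_cast (X : ℤ → ModuleCat.{u} R) (d : ∀ n : ℤ, X n →ₗ[R] X (n + 1))
    (h2 : ∀ n, LinearMap.range (d n) = LinearMap.ker (d (n + 1))) (W : ModuleCat.{u} R)
    (h : ∀ (n : ℤ) (φ : W →ₗ[R] X (n + 1)), (d (n + 1)).comp φ = 0 →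
        ∃ ψ : W →ₗ[R] X n, (d n).comp ψ = φ) (n m : ℤ) (hnm : n + 1 = m) :
    ∃ δ : X n →ₗ[R] X m, LinearMap.range δ = LinearMap.ker (d m) ∧
      ∀ (φ : W →ₗ[R] X m), (d m).comp φ = 0 → ∃ ψ : W →ₗ[R] X n, δ.comp ψ = φ := by
  subst hnm
  exact ⟨d n, h2 n, h n⟩

theorem injective_of_gi_id (N : ModuleCat.{u} R) (hN : IsGorensteinInjective R N) (k : ℕ)
    (hk : HasInjectiveDimensionLT N (k + 1)) : Module.Injective R N := by
  obtain ⟨X, d, h1, h2, h3, ⟨e⟩⟩ := hN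
  obtain ⟨δ, hδ, hl⟩ := gi_cast X d h2 N (gi_lift X d h1 h2 h3 k N hk) (-1) 0 (by norm_num)
  obtain ⟨ψ, hψ⟩ := hl ((LinearMap.ker (d 0)).subtype.comp e.toLinearMap) (by
    ext x; exact (e x).2)
  refine inj_retract N (X (-1)) (h1 _) ψ
    (e.symm.toLinearMap.comp (δ.codRestrict (LinearMap.ker (d 0)) (fun x => hδ ▸ ⟨x, rfl⟩))) ?_
  intro x
  change e.symm _ = x
  rw [LinearEquiv.symm_apply_eq]
  apply Subtype.ext
  exact LinearMap.congr_fun hψ x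

variable [IsNoetherianRing R]

lemma inj_loc (S : Submonoid R) (N : ModuleCat.{u} R) (hN : Module.Injective R N) :
    Module.Injective R (LocalizedModule S N) := by
  apply Module.Baer.injective
  intro I f
  have : Module.FinitePresentation R I := Module.finitePresentation_of_finite R I
  obtain ⟨g, s, hg⟩ := Module.FinitePresentation.exists_lift_of_isLocalizedModule S
    (LocalizedModule.mkLinearMap S N) f
  obtain ⟨G, hG⟩ := hN.out I.subtype Subtype.val_injective g
  refine ⟨LinearMap.toSpanSingleton R _ (LocalizedModule.mk (G 1) s), fun r hr => ?_⟩
  have h1 := LinearMap.congr_fun hg ⟨r, hr⟩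
  have h2 : G r = g ⟨r, hr⟩ := hG ⟨r, hr⟩
  have hu := IsLocalizedModule.map_units (LocalizedModule.mkLinearMap S N) s
  apply ((Module.End.isUnit_iff _).1 hu).1
  change (s : R) • (r • LocalizedModule.mk (G 1) s) = (s : R) • f ⟨r, hr⟩
  refine Eq.trans ?_ h1
  change _ = LocalizedModule.mkLinearMap S N (g ⟨r, hr⟩)
  rw [← h2, smul_comm]
  have : (s : R) • LocalizedModule.mk (G 1) s = LocalizedModule.mkLinearMap S N (G 1) := by
    rw [LocalizedModule.smul'_mk, LocalizedModule.mkLinearMap_apply, ]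
    exact LocalizedModule.mk_cancel s (G 1)
  rw [this, ← map_smul, ← map_smul, smul_eq_mul, mul_one]

lemma id_loc (S : Submonoid R) (k : ℕ) : ∀ (N : ModuleCat.{u} R)
    (_ : HasInjectiveDimensionLT N (k + 1)),
    HasInjectiveDimensionLT (ModuleCat.of R (LocalizedModule S N)) (k + 1) := by
  induction k with
  | zero =>
    intro N hN
    rw [zero_add, ← injective_iff_hasInjectiveDimensionLT_one,
      ← Module.injective_iff_injective_object] at hN ⊢
    exact inj_loc S N hN
  | succ k ih =>
    intro N hN
    obtain ⟨J, C, f, g, hJ, hf, hex, hg⟩ := exists_inj_coker N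
    have hJ' : Injective J := Module.injective_object_of_injective_module R J
    have hS := sc_se f g hex hf hg
    have hC := ih C ((hS.hasInjectiveDimensionLT_X₃_iff k hJ').2 hN)
    have hJl := inj_loc S J hJ
    have hJl' : Injective (ModuleCat.of R (LocalizedModule S J)) :=
      Module.injective_object_of_injective_module R _
    have hS' := sc_se (A := ModuleCat.of R (LocalizedModule S N))
      (B := ModuleCat.of R (LocalizedModule S J)) (C := ModuleCat.of R (LocalizedModule S C))
      _ _ (LocalizedModule.map_exact S f g hex)
      (IsLocalizedModule.map_injective S _ _ f hf) (IsLocalizedModule.map_surjective S _ _ g hg)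
    exact (hS'.hasInjectiveDimensionLT_X₃_iff k hJl').1 hC

lemma id_finSupp (S : Set (PrimeSpectrum R)) (N : ModuleCat.{u} R) (k : ℕ)
    (h : HasInjectiveDimensionLT N (k + 1)) :
    HasInjectiveDimensionLT (ModuleCat.of R (finSupp R S N)) (k + 1) := by
  classical
  refine hasInj_of_ideal k _ fun I => ?_
  refine ext_vanish_sum _ (ι := S)
    (fun p => ModuleCat.of R (LocalizedModule p.1.asIdeal.primeCompl N))
    (fun p => fsProj S N p) (fun p => fsIncl S N p) (fs_sum S N) _ _ ?_
  intro p
  have := id_loc p.1.asIdeal.primeCompl k N h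
  exact HasInjectiveDimensionLT.subsingleton _ (k + 1) (k + 1) le_rfl _

end GorInj
end GG

namespace GG

section Final
open CategoryTheory Abelian

variable {R : Type u} [CommRing R]

lemma fd_equiv {W W' : ModuleCat.{u} R} (e : W ≃ₗ[R] W') (n : ℕ) (h : fdLE R W n) :
    fdLE R W' n := by
  obtain ⟨G, d, ε, h1, h2, h3, h4, h5⟩ := h
  refine ⟨G, d, e.toLinearMap.comp ε, h1, e.surjective.comp h2, ?_, h4, h5⟩
  rw [← h3]
  ext x
  simp

variable [IsLocalRing R] [IsNoetherianRing R]

theorem main_result (M : ModuleCat.{u} R) (hM : IsGGorenstein R M) (d : ℕ)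
    (hd : mdim R M = (d : WithBot ℕ∞))
    (hfd : ∃ n, fdLE R ((localCohomology (IsLocalRing.maximalIdeal R) d).obj M) n) :
    IsGorensteinLocalRing R ∧ IsGorensteinModule R M := by
  obtain ⟨h0, hfin, h1, h2, h3, h4⟩ := hM
  let F := heightFiltration R M
  let S := cousinSplit F M h1 h2 h3
  -- vanishing
  have hquot : ∀ t : ℕ, ∀ j < d, ∀ i, Subsingleton (Ext.{u}
      (ModuleCat.of R (R ⧸ IsLocalRing.maximalIdeal R ^ t)) (ModuleCat.of R (cousinC R F M j)) i) := by
    intro t j hj i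
    refine ext_C_zero M h0 d hd _ t ?_ j hj i
    intro r hr y
    obtain ⟨y, rfl⟩ := Submodule.Quotient.mk_surjective _ y
    change Submodule.Quotient.mk (r • y) = _
    rw [Submodule.Quotient.mk_eq_zero]
    exact Ideal.mul_mem_right _ _ hr
  have htors := K_torsion M h0 d hd h1
  -- local cohomology
  obtain ⟨e⟩ := locCoh_equiv (IsLocalRing.maximalIdeal R) (cousinK R F M d) M d (S.om d)
    (fun t => S.bij _ d (hquot t) 0 d (zero_add d)) htors
  obtain ⟨n, hn⟩ := hfd
  have hfl : FlatDim n (cousinK R F M d) := flatDim_of_fdLE n _ (fd_equiv e n hn)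
  -- `K_d` is Gorenstein injective
  have hbij : Function.Bijective (S.f d) := by
    refine ⟨S.inj d, fun y => ?_⟩
    exact (S.ex d y).1 (K_succ_zero M h0 d hd h1 _)
  have hgi : IsGorensteinInjective R (cousinK R F M d) :=
    gi_equiv (LinearEquiv.ofBijective (S.f d) hbij).symm (h4 d)
  have hinj : Module.Injective R (cousinK R F M d) :=
    injective_of_gorensteinInjective_fd _ hgi n hfl
  have hinj' : Injective (cousinK R F M d) := Module.injective_object_of_injective_module R _
  -- Ext from the residue field
  have hk : ∀ j < d, ∀ i, Subsingleton (Ext.{u}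
      (ModuleCat.of R (R ⧸ IsLocalRing.maximalIdeal R)) (ModuleCat.of R (cousinC R F M j)) i) := by
    have := hquot 1
    rwa [pow_one] at this
  have hup : ∀ i, Subsingleton (Ext.{u} (ModuleCat.of R (R ⧸ IsLocalRing.maximalIdeal R))
      (cousinK R F M d) i) → Subsingleton (Ext.{u} (ModuleCat.of R (R ⧸ IsLocalRing.maximalIdeal R))
      M (i + d)) := fun i hi =>
    (S.bij _ d hk i (i + d) rfl).surjective.subsingleton
  have hid : HasInjectiveDimensionLT M (d + 1) := by
    refine hasInj_of_ideal d M fun I => bass M (d + 1) (fun i hi => ?_) I (d + 1) le_rfl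
    obtain ⟨j, rfl⟩ := Nat.exists_eq_add_of_le hi
    have := hup (j + 1) (subsingleton_of_forall_eq 0 fun e =>
      Ext.eq_zero_of_injective (I := cousinK R F M d) e)
    rwa [show d + 1 + j = j + 1 + d by omega]
  have hne : ∃ x : cousinK R F M d, x ≠ 0 := by
    by_contra! hz
    obtain ⟨x, hx⟩ := h0
    refine hx (subsingleton_of_ext_bot M (bass M 0 (fun i _ => ?_) ⊥ 0 le_rfl) x)
    rcases lt_or_ge i d with hi | hi
    · exact S.low _ i (fun j hj => hk j (lt_of_le_of_lt hj hi))
    · obtain ⟨j, rfl⟩ := Nat.exists_eq_add_of_le hi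
      rw [add_comm]
      refine hup j (subsingleton_of_forall_eq 0 fun e => ?_)
      have h : 𝟙 (cousinK R F M d) = 0 := by
        apply ModuleCat.hom_ext
        ext x
        rw [hz x, map_zero, map_zero]
      rw [← Ext.comp_mk₀_id e, h, Ext.mk₀_zero, Ext.comp_zero]
  -- socle element
  have hsoc : ∀ t : ℕ, ∀ x : cousinK R F M d, x ≠ 0 →
      (∀ r ∈ IsLocalRing.maximalIdeal R ^ t, r • x = 0) →
      ∃ y : cousinK R F M d, y ≠ 0 ∧ ∀ r ∈ IsLocalRing.maximalIdeal R, r • y = 0 := by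
    intro t
    induction t with
    | zero =>
      intro x hx h
      exact absurd (by simpa using h 1 (by simp)) hx
    | succ t ih =>
      intro x hx h
      by_cases hr : ∃ r ∈ IsLocalRing.maximalIdeal R, r • x ≠ 0
      · obtain ⟨r, hr, hrx⟩ := hr
        refine ih (r • x) hrx fun s hs => ?_
        rw [smul_smul]
        exact h _ (by rw [pow_succ]; exact Ideal.mul_mem_mul hs hr)
      · push Not at hr
        exact ⟨x, hx, hr⟩
  obtain ⟨x, hx⟩ := hne
  obtain ⟨t, ht⟩ := htors x
  obtain ⟨y, hy, hym⟩ := hsoc t x hx ht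
  refine ⟨⟨inferInstance, gorenstein_of _ n hfl y hy hym⟩, h0, hfin, h1, h2, h3, ?_⟩
  have hidK : ∀ m, HasInjectiveDimensionLT (cousinK R F M m) (d + 1) ∧
      Module.Injective R (cousinC R F M m) := by
    have hC : ∀ m, HasInjectiveDimensionLT (cousinK R F M m) (d + 1) →
        Module.Injective R (cousinC R F M m) := fun m hm =>
      injective_of_gi_id (ModuleCat.of R (cousinC R F M m)) (h4 m) d (id_finSupp _ _ d hm)
    intro m
    induction m with
    | zero => exact ⟨hid, hC 0 hid⟩
    | succ m ih =>
      have hc := ih.2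
      have hc' : Injective (ModuleCat.of R (cousinC R F M m)) :=
        Module.injective_object_of_injective_module R _
      have hc2 : HasInjectiveDimensionLT (ModuleCat.of R (cousinC R F M m)) (d + 1) :=
        hasInjectiveDimensionLT_of_ge _ 1 (d + 1) (by omega)
      have hk2 : HasInjectiveDimensionLT (cousinK R F M m) (d + 1 + 1) :=
        have := ih.1
        hasInjectiveDimensionLT_of_ge _ (d + 1) (d + 1 + 1) (by omega)
      have := (S.se m).hasInjectiveDimensionLT_X₃ (d + 1) hc2 hk2
      exact ⟨this, hC (m + 1) this⟩
  exact fun m => (hidK m).2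

end Final
end GG

open GG IsLocalRing in
/-- If the top local cohomology of a G–Gorenstein module has finite flat dimension, then
the ring and the module are Gorenstein. -/
theorem stmt10 (R : Type u) [CommRing R] [IsLocalRing R] [IsNoetherianRing R]
    (M : ModuleCat.{u} R) (hM : IsGGorenstein R M) (d : ℕ)
    (hd : mdim R M = (d : WithBot ℕ∞))
    (hfd : ∃ n, fdLE R ((localCohomology (maximalIdeal R) d).obj M) n) :
    IsGorensteinLocalRing R ∧ IsGorensteinModule R M := by
  exact GG.main_result M hM d hd hfd
end

section
/- Let R be a Cohen–Macaulay Noetherian local ring of dimension d with dualizing complex, M a G–Gorenstein R-module, and N a Cohen–Macaulay R-module of finite injective or projective dimension with dim_R N = s. Then Ext_R^i(N, M) = 0 for all i ≠ d − s, and Ext_R^{d−s}(N, M) is a Cohen–Macaulay R-module of dimension s. -/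
universe u

namespace GGP
open CategoryTheory Opposite Abelian

variable {R : Type u} [CommRing R]

section compare
variable {N M : ModuleCat.{u} R} (P : ProjectiveResolution N)

/-- Cocycles. -/
def Zc (M : ModuleCat.{u} R) (n : ℕ) : Submodule R (P.complex.X n ⟶ M) where
  carrier := {f | P.complex.d (n+1) n ≫ f = 0}
  add_mem' := by
    intro a b ha hb
    simp only [Set.mem_ofPred_eq] at *
    simp [ha, hb]
  zero_mem' := by simp
  smul_mem' := by
    intro c a ha
    simp only [Set.mem_ofPred_eq] at *
    simp [ha]

noncomputable def toNew (M : ModuleCat.{u} R) (n : ℕ) : Zc P M n →ₗ[R] Abelian.Ext N M n where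
  toFun f := P.extMk f.1 (n+1) rfl f.2
  map_add' f g := (P.add_extMk _ _ _ _ _ _).symm
  map_smul' r f := by
    rw [Ext.smul_eq_comp_mk₀]
    refine Eq.trans ?_ (P.extMk_comp_mk₀ f.1 (n+1) rfl f.2 (r • 𝟙 M)).symm
    congr 1

lemma toNew_surj (n : ℕ) : Function.Surjective (toNew P M n) := by
  intro α
  obtain ⟨f, hf, h⟩ := P.extMk_surjective α (n+1) rfl
  exact ⟨⟨f, hf⟩, h⟩

open CochainComplex HomComplex in
lemma toNew_ker (n : ℕ) (f : Zc P M n) : toNew P M n f = 0 ↔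
   ∃ g : P.complex.X ((ComplexShape.up ℕ).prev n) ⟶ M,
    P.complex.d n ((ComplexShape.up ℕ).prev n) ≫ g = f.1 := by
  cases n with
  | succ n =>
    rw [show (ComplexShape.up ℕ).prev (n+1) = n by simp]
    exact P.extMk_eq_zero_iff f.1 (n+1+1) rfl f.2 n rfl
  | zero =>
    have h0 : (ComplexShape.up ℕ).prev 0 = 0 := by simp
    have h1 : P.complex.d 0 ((ComplexShape.up ℕ).prev 0) = 0 :=
      P.complex.shape _ _ (by simp)
    simp only [h1, Limits.zero_comp]
    obtain ⟨f, hf⟩ := f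
    constructor
    · intro h
      refine ⟨0, ?_⟩
      have hf1 : P.complex.d (0+1) 0 ≫ f = 0 := hf
      replace h : P.extMk f (0+1) rfl hf1 = 0 := h
      simp only [← P.extEquivCohomologyClass.apply_eq_iff_eq,
        ProjectiveResolution.extEquivCohomologyClass_extMk,
        ProjectiveResolution.extEquivCohomologyClass_zero,
        CohomologyClass.mk_eq_zero_iff] at h
      rw [Cocycle.toSingleMk_mem_coboundaries_iff _ _ _ _ _ 1 (by lia)] at h
      obtain ⟨g, hg⟩ := h
      have : g = 0 := (CochainComplex.isZero_of_isStrictlyLE P.cochainComplex 0 1).eq_of_src _ _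
      subst this
      simp only [Limits.comp_zero] at hg
      rw [← cancel_epi (P.cochainComplexXIso (-(0:ℕ)) 0 rfl).hom, ← hg]
      simp
    · rintro ⟨g, hg⟩
      simp only at hg
      subst hg
      exact P.extMk_zero (0+1) rfl

noncomputable def scHom (S : ShortComplex (ModuleCat.{u} R)) :
    LinearMap.ker S.g.hom →ₗ[R] S.homology :=
  S.moduleCatHomologyIso.inv.hom.comp (LinearMap.range S.moduleCatToCycles).mkQ

lemma scHom_surj (S : ShortComplex (ModuleCat.{u} R)) : Function.Surjective (scHom S) :=
  ((ModuleCat.epi_iff_surjective S.moduleCatHomologyIso.inv).1 inferInstance).comp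
    (Submodule.mkQ_surjective _)

lemma scHom_ker (S : ShortComplex (ModuleCat.{u} R)) (f : LinearMap.ker S.g.hom) :
    scHom S f = 0 ↔ ∃ g : S.X₁, S.f.hom g = f.1 := by
  have h : Function.Injective S.moduleCatHomologyIso.inv.hom :=
    (ModuleCat.mono_iff_injective _).1 inferInstance
  have h2 : scHom S f = 0 ↔ (LinearMap.range S.moduleCatToCycles).mkQ f = 0 :=
    map_eq_zero_iff _ h
  rw [h2, Submodule.mkQ_apply, Submodule.Quotient.mk_eq_zero]
  constructor
  · rintro ⟨g, hg⟩
    exact ⟨g, congrArg Subtype.val hg⟩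
  · rintro ⟨g, hg⟩
    exact ⟨g, Subtype.ext hg⟩

lemma mem_ker_sc (n : ℕ) (c : P.complex.X n ⟶ M) :
    ((P.complex.linearYonedaObj R M).sc n).g.hom c = 0 ↔ c ∈ Zc P M n := by
  change (P.complex.linearYonedaObj R M).d n _ c = 0 ↔ _
  rw [show (ComplexShape.up ℕ).next n = n+1 by simp]
  exact Iff.rfl

noncomputable def toKer (M : ModuleCat.{u} R) (n : ℕ) :
    Zc P M n →ₗ[R] LinearMap.ker ((P.complex.linearYonedaObj R M).sc n).g.hom where
  toFun c := ⟨c.1, (mem_ker_sc P n c.1).2 c.2⟩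
  map_add' _ _ := rfl
  map_smul' _ _ := rfl

noncomputable def toHom (M : ModuleCat.{u} R) (n : ℕ) :
    Zc P M n →ₗ[R] (P.complex.linearYonedaObj R M).homology n :=
  (scHom _).comp (toKer P M n)

lemma toHom_surj (n : ℕ) : Function.Surjective (toHom P M n) := by
  refine (scHom_surj _).comp ?_
  rintro ⟨c, hc⟩
  exact ⟨⟨c, (mem_ker_sc P n c).1 hc⟩, rfl⟩

lemma toHom_ker (n : ℕ) (f : Zc P M n) : toHom P M n f = 0 ↔
   ∃ g : P.complex.X ((ComplexShape.up ℕ).prev n) ⟶ M,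
    P.complex.d n ((ComplexShape.up ℕ).prev n) ≫ g = f.1 :=
  scHom_ker _ (toKer P M n f)

noncomputable def extEquiv (N M : ModuleCat.{u} R) (n : ℕ) :
    (((_root_.Ext R (ModuleCat.{u} R) n).obj (op N)).obj M) ≃ₗ[R] Abelian.Ext N M n :=
  let P := ProjectiveResolution.of N
  (P.isoExt n M).toLinearEquiv ≪≫ₗ ((toHom P M n).quotKerEquivOfSurjective (toHom_surj P n)).symm ≪≫ₗ
    Submodule.quotEquivOfEq _ _ (by
      ext f
      rw [LinearMap.mem_ker, LinearMap.mem_ker, toHom_ker, toNew_ker]) ≪≫ₗ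
   ((toNew P M n).quotKerEquivOfSurjective (toNew_surj P n))
end compare
end GGP

namespace GGP
open CategoryTheory Opposite Abelian

variable {R : Type u} [CommRing R]

section les
variable {S : ShortComplex (ModuleCat.{u} R)}

lemma cov1 (hS : S.ShortExact) (X : ModuleCat.{u} R) {n : ℕ} (h3 : Subsingleton (Ext X S.X₃ n)) (h2 : Subsingleton (Ext X S.X₂ (n+1))) :
    Subsingleton (Ext X S.X₁ (n+1)) := by
  refine subsingleton_of_forall_eq 0 fun a => ?_
  obtain ⟨b, rfl⟩ := Ext.covariant_sequence_exact₁ X hS a (Subsingleton.elim _ _) rfl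
  rw [Subsingleton.elim b 0, Ext.zero_comp]

lemma cov3 (hS : S.ShortExact) (X : ModuleCat.{u} R) {n : ℕ} (h2 : Subsingleton (Ext X S.X₂ n)) (h1 : Subsingleton (Ext X S.X₁ (n+1))) :
    Subsingleton (Ext X S.X₃ n) := by
  refine subsingleton_of_forall_eq 0 fun a => ?_
  obtain ⟨b, rfl⟩ := Ext.covariant_sequence_exact₃ X hS a rfl (Subsingleton.elim _ _)
  rw [Subsingleton.elim b 0, Ext.zero_comp]

lemma contra3 (hS : S.ShortExact) (X : ModuleCat.{u} R) {n : ℕ} (h1 : Subsingleton (Ext S.X₁ X n)) (h2 : Subsingleton (Ext S.X₂ X (n+1))) :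
    Subsingleton (Ext S.X₃ X (n+1)) := by
  refine subsingleton_of_forall_eq 0 fun a => ?_
  obtain ⟨b, rfl⟩ := Ext.contravariant_sequence_exact₃ hS X a (Subsingleton.elim _ _) (add_comm _ _)
  rw [Subsingleton.elim b 0, Ext.comp_zero]

lemma contra1 (hS : S.ShortExact) (X : ModuleCat.{u} R) {n : ℕ} (h2 : Subsingleton (Ext S.X₂ X n)) (h3 : Subsingleton (Ext S.X₃ X (n+1))) :
    Subsingleton (Ext S.X₁ X n) := by
  refine subsingleton_of_forall_eq 0 fun a => ?_
  obtain ⟨b, rfl⟩ := Ext.contravariant_sequence_exact₁ hS X a (add_comm _ _) (Subsingleton.elim _ _)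
  rw [Subsingleton.elim b 0, Ext.comp_zero]

lemma contra2 (hS : S.ShortExact) (X : ModuleCat.{u} R) {n : ℕ} (h1 : Subsingleton (Ext S.X₁ X n)) (h3 : Subsingleton (Ext S.X₃ X n)) :
    Subsingleton (Ext S.X₂ X n) := by
  refine subsingleton_of_forall_eq 0 fun a => ?_
  obtain ⟨b, rfl⟩ := Ext.contravariant_sequence_exact₂ hS X a (Subsingleton.elim _ _)
  rw [Subsingleton.elim b 0, Ext.comp_zero]

end les

lemma sub_of_iso {X Y Y' : ModuleCat.{u} R} (e : Y ≅ Y') {n : ℕ} (h : Subsingleton (Ext X Y n)) :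
    Subsingleton (Ext X Y' n) := by
  refine subsingleton_of_forall_eq 0 fun a => ?_
  have : a = (a.comp (Ext.mk₀ e.inv) (add_zero _)).comp (Ext.mk₀ e.hom) (add_zero _) := by
    simp
  rw [this, Subsingleton.elim (a.comp (Ext.mk₀ e.inv) (add_zero _)) 0, Ext.zero_comp]

lemma sub_of_iso' {X X' Y : ModuleCat.{u} R} (e : X ≅ X') {n : ℕ} (h : Subsingleton (Ext X Y n)) :
    Subsingleton (Ext X' Y n) := by
  refine subsingleton_of_forall_eq 0 fun a => ?_
  have : a = (Ext.mk₀ e.inv).comp ((Ext.mk₀ e.hom).comp a (zero_add _)) (zero_add _) := by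
    simp
  rw [this, Subsingleton.elim ((Ext.mk₀ e.hom).comp a (zero_add _)) 0, Ext.comp_zero]

lemma sub_right {X Y : ModuleCat.{u} R} (h : Subsingleton Y) (n : ℕ) : Subsingleton (Ext X Y n) := by
  have h0 : (𝟙 Y : Y ⟶ Y) = 0 := (ModuleCat.isZero_of_subsingleton Y).eq_of_src _ _
  refine subsingleton_of_forall_eq 0 fun a => ?_
  rw [← a.comp_mk₀_id, h0, Ext.mk₀_zero, Ext.comp_zero]

lemma sub_left {X Y : ModuleCat.{u} R} (h : Subsingleton X) (n : ℕ) : Subsingleton (Ext X Y n) := by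
  have h0 : (𝟙 X : X ⟶ X) = 0 := (ModuleCat.isZero_of_subsingleton X).eq_of_src _ _
  refine subsingleton_of_forall_eq 0 fun a => ?_
  rw [← a.mk₀_id_comp, h0, Ext.mk₀_zero, Ext.zero_comp]

/-- Short complex from linear maps. -/
abbrev mkS {A B C : Type u} [AddCommGroup A] [AddCommGroup B] [AddCommGroup C] [Module R A]
    [Module R B] [Module R C] (f : A →ₗ[R] B) (g : B →ₗ[R] C) (h : Function.Exact f g) :
    ShortComplex (ModuleCat.{u} R) :=
  ShortComplex.mk (ModuleCat.ofHom f) (ModuleCat.ofHom g)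
    (by ext x; exact h.apply_apply_eq_zero x)

lemma mkS_exact {A B C : Type u} [AddCommGroup A] [AddCommGroup B] [AddCommGroup C] [Module R A]
    [Module R B] [Module R C] (f : A →ₗ[R] B) (g : B →ₗ[R] C) (h : Function.Exact f g)
    (hf : Function.Injective f) (hg : Function.Surjective g) :
    (mkS f g h).ShortExact where
  exact := ModuleCat.shortComplex_exact _ h
  mono_f := (ModuleCat.mono_iff_injective _).2 hf
  epi_g := (ModuleCat.epi_iff_surjective _).2 hg

section TA

/-- Totally acyclic complexes of injectives. -/
structure TA (X : ℤ → ModuleCat.{u} R) (d : ∀ n : ℤ, X n →ₗ[R] X (n + 1)) : Prop where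
  inj : ∀ n, Module.Injective R (X n)
  ex : ∀ n, LinearMap.range (d n) = LinearMap.ker (d (n + 1))
  hom : ∀ (I : ModuleCat.{u} R), Module.Injective R I →
      ∀ (n : ℤ) (φ : I →ₗ[R] X (n + 1)), (d (n + 1)).comp φ = 0 →
        ∃ ψ : I →ₗ[R] X n, (d n).comp ψ = φ

variable {X : ℤ → ModuleCat.{u} R} {d : ∀ n : ℤ, X n →ₗ[R] X (n + 1)}

lemma TA.ses (h : TA X d) (n : ℤ) : ∃ (f : LinearMap.ker (d n) →ₗ[R] X n) (g : X n →ₗ[R] LinearMap.ker (d (n+1)))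
    (hex : Function.Exact f g), (mkS f g hex).ShortExact ∧ ∀ x, (g x).1 = d n x := by
  refine ⟨(LinearMap.ker (d n)).subtype, (d n).codRestrict _ (fun x => ?_), ?_, ?_, ?_⟩
  · rw [← h.ex]; exact ⟨x, rfl⟩
  · intro x
    constructor
    · intro hx
      exact ⟨⟨x, congrArg Subtype.val hx⟩, rfl⟩
    · rintro ⟨y, rfl⟩
      exact Subtype.ext y.2
  · refine mkS_exact _ _ _ Subtype.val_injective ?_
    rintro ⟨y, hy⟩
    have hy' := hy
    rw [← h.ex] at hy'
    obtain ⟨x, hx⟩ := hy'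
    exact ⟨x, Subtype.ext hx⟩
  · intro x; rfl

lemma TA.Xvan (h : TA X d) (N : ModuleCat.{u} R) (n : ℤ) (i : ℕ) : Subsingleton (Ext N (X n) (i+1)) := by
  have := h.inj n
  have : Injective (X n) := Module.injective_object_of_injective_module (R := R) (M := X n)
  exact Ext.subsingleton_of_injective _ _ _

lemma TA.inj_van (h : TA X d) (I : ModuleCat.{u} R) (hI : Module.Injective R I) (i : ℕ) (n : ℤ) :
    Subsingleton (Ext I (ModuleCat.of R (LinearMap.ker (d n))) (i+1)) := by
  induction i generalizing n with
  | zero =>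
    obtain ⟨f, g, hex, hS, hg⟩ := h.ses n
    refine subsingleton_of_forall_eq 0 fun a => ?_
    have := h.Xvan I n 0
    obtain ⟨b, rfl⟩ := Ext.covariant_sequence_exact₁ I hS a (Subsingleton.elim _ _) rfl
    obtain ⟨b, rfl⟩ := (Ext.mk₀_bijective _ _).2 b
    obtain ⟨ψ, hψ⟩ := h.hom I hI n ((Submodule.subtype _).comp b.hom) (by
      ext x
      exact (b.hom x).2)
    have : b = ModuleCat.ofHom ψ ≫ (mkS f g hex).g := by
      apply ModuleCat.hom_ext
      apply LinearMap.ext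
      intro x
      exact Subtype.ext ((LinearMap.congr_fun hψ x).symm.trans (hg _).symm)
    rw [this, ← Ext.mk₀_comp_mk₀, Ext.comp_assoc_of_second_deg_zero, hS.comp_extClass,
      Ext.comp_zero]
  | succ i ih =>
    obtain ⟨f, g, hex, hS, hg⟩ := h.ses n
    exact cov1 hS I (ih (n+1)) (h.Xvan _ _ _)
end TA

/-- Eventual vanishing against Gorenstein injectives. -/
def QF (N : ModuleCat.{u} R) : Prop :=
  ∃ n0 : ℕ, ∀ (X : ℤ → ModuleCat.{u} R) (d : ∀ n : ℤ, X n →ₗ[R] X (n + 1)), TA X d →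
    ∀ (m : ℤ) (i : ℕ), n0 < i → Subsingleton (Ext N (ModuleCat.of R (LinearMap.ker (d m))) i)

lemma QF.all {N : ModuleCat.{u} R} (hN : QF N) {X : ℤ → ModuleCat.{u} R}
    {d : ∀ n : ℤ, X n →ₗ[R] X (n + 1)} (h : TA X d) (i : ℕ) (m : ℤ) :
    Subsingleton (Ext N (ModuleCat.of R (LinearMap.ker (d m))) (i+1)) := by
  obtain ⟨n0, hn⟩ := hN
  have key : ∀ k i m, n0 < i + 1 + k →
      Subsingleton (Ext N (ModuleCat.of R (LinearMap.ker (d m))) (i+1)) := by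
    intro k
    induction k with
    | zero => intro i m hi; exact hn X d h m _ hi
    | succ k ih =>
      intro i m hi
      obtain ⟨n, rfl⟩ : ∃ n, m = n + 1 := ⟨m - 1, by lia⟩
      obtain ⟨f, g, hex, hS, hg⟩ := h.ses n
      exact cov3 hS N (h.Xvan _ _ _) (ih (i+1) n (by lia))
  exact key n0 i m (by lia)

lemma QF.gi {N : ModuleCat.{u} R} (hN : QF N) (G : ModuleCat.{u} R)
    (hG : GG.IsGorensteinInjective R G) (i : ℕ) : Subsingleton (Ext N G (i+1)) := by
  obtain ⟨X, d, h1, h2, h3, ⟨e⟩⟩ := hG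
  exact sub_of_iso e.symm.toModuleIso (hN.all ⟨h1, h2, h3⟩ i 0)

lemma QF.of_iso {N N' : ModuleCat.{u} R} (e : N ≅ N') (hN : QF N) : QF N' := by
  obtain ⟨n0, hn⟩ := hN
  exact ⟨n0, fun X d h m i hi => sub_of_iso' e (hn X d h m i hi)⟩

lemma QF.of_subsingleton {N : ModuleCat.{u} R} (h : Subsingleton N) : QF N :=
  ⟨0, fun X d _ m i hi => sub_left h i⟩

lemma QF.of_inj {N : ModuleCat.{u} R} (h : Module.Injective R N) : QF N :=
  ⟨0, fun X d hX m i hi => by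
    obtain ⟨j, rfl⟩ : ∃ j, i = j + 1 := ⟨i - 1, by lia⟩
    exact hX.inj_van N h j m⟩

lemma QF.of_proj {N : ModuleCat.{u} R} (h : Module.Projective R N) : QF N :=
  ⟨0, fun X d hX m i hi => by
    obtain ⟨j, rfl⟩ : ∃ j, i = j + 1 := ⟨i - 1, by lia⟩
    have : Projective N := (IsProjective.iff_projective (R := R) N).1 h
    exact Ext.subsingleton_of_projective _ _ _⟩

lemma QF.left {S : ShortComplex (ModuleCat.{u} R)} (hS : S.ShortExact) (h2 : QF S.X₂)
    (h3 : QF S.X₃) : QF S.X₁ := by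
  obtain ⟨n2, h2⟩ := h2
  obtain ⟨n3, h3⟩ := h3
  exact ⟨n2 + n3, fun X d h m i hi => contra1 hS _ (h2 X d h m i (by lia)) (h3 X d h m _ (by lia))⟩

lemma QF.right {S : ShortComplex (ModuleCat.{u} R)} (hS : S.ShortExact) (h2 : QF S.X₂)
    (h1 : QF S.X₁) : QF S.X₃ := by
  obtain ⟨n2, h2⟩ := h2
  obtain ⟨n1, h1⟩ := h1
  refine ⟨n2 + n1 + 1, fun X d h m i hi => ?_⟩
  obtain ⟨j, rfl⟩ : ∃ j, i = j + 1 := ⟨i - 1, by lia⟩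
  exact contra3 hS _ (h1 X d h m j (by lia)) (h2 X d h m _ (by lia))

lemma QF.of_id {N : ModuleCat.{u} R} {n : ℕ} (h : GG.idLE R N n) : QF N := by
  obtain ⟨G, d, ε, hG, hε, h0, hd, hz⟩ := h
  have key : ∀ k i, n < i + k → QF (ModuleCat.of R (LinearMap.ker (d i))) := by
    intro k
    induction k with
    | zero =>
      intro i hi
      apply QF.of_subsingleton
      refine ⟨fun a b => Subtype.ext ?_⟩
      rw [hz i hi a.1, hz i hi b.1]
    | succ k ih =>
      intro i hi
      have hc : ∀ x, d i x ∈ LinearMap.ker (d (i+1)) := fun x => by rw [← hd]; exact ⟨x, rfl⟩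
      have hex : Function.Exact (LinearMap.ker (d i)).subtype ((d i).codRestrict _ hc) := by
        intro x
        constructor
        · intro hx
          exact ⟨⟨x, congrArg Subtype.val hx⟩, rfl⟩
        · rintro ⟨y, rfl⟩
          exact Subtype.ext y.2
      have hS : (mkS _ _ hex).ShortExact := by
        refine mkS_exact _ _ _ Subtype.val_injective ?_
        rintro ⟨y, hy⟩
        have hy' := hy
        rw [← hd] at hy'
        obtain ⟨x, hx⟩ := hy'
        exact ⟨x, Subtype.ext hx⟩
      exact QF.left hS (QF.of_inj (hG i)) (ih (i+1) (by lia))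
  have e : N ≃ₗ[R] LinearMap.ker (d 0) :=
    (LinearEquiv.ofInjective ε hε).trans (LinearEquiv.ofEq _ _ h0)
  exact QF.of_iso e.symm.toModuleIso (key (n+1) 0 (by lia))

lemma QF.of_pd {N : ModuleCat.{u} R} {n : ℕ} (h : GG.pdLE R N n) : QF N := by
  obtain ⟨G, d, ε, hG, hε, h0, hd, hz⟩ := h
  have key : ∀ k i, n < i + k → QF (ModuleCat.of R (LinearMap.range (d i))) := by
    intro k
    induction k with
    | zero =>
      intro i hi
      apply QF.of_subsingleton
      refine ⟨fun a b => Subtype.ext ?_⟩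
      obtain ⟨_, a, rfl⟩ := a
      obtain ⟨_, b, rfl⟩ := b
      simp [hz (i+1) (by lia) a, hz (i+1) (by lia) b]
    | succ k ih =>
      intro i hi
      have hex : Function.Exact (LinearMap.range (d (i+1))).subtype (d i).rangeRestrict := by
        intro x
        rw [← hd]
        constructor
        · intro hx
          exact ⟨⟨x, congrArg Subtype.val hx⟩, rfl⟩
        · rintro ⟨y, rfl⟩
          exact Subtype.ext y.2
      have hS : (mkS _ _ hex).ShortExact :=
        mkS_exact _ _ _ Subtype.val_injective (d i).surjective_rangeRestrict
      exact QF.right hS (QF.of_proj (hG (i+1))) (ih (i+1) (by lia))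
  have hex : Function.Exact (LinearMap.range (d 0)).subtype ε := by
    rw [← h0]
    intro x
    constructor
    · intro hx
      exact ⟨⟨x, hx⟩, rfl⟩
    · rintro ⟨y, rfl⟩
      exact y.2
  have hS : (mkS _ _ hex).ShortExact := mkS_exact _ _ _ Subtype.val_injective hε
  exact QF.right hS (QF.of_proj (hG 0)) (key (n+1) 0 (by lia))

end GGP

namespace GGP
open CategoryTheory Opposite Abelian

variable {R : Type u} [CommRing R]

section Cousin
variable {F : ℕ → Set (PrimeSpectrum R)} {M : ModuleCat.{u} R} {P : ModuleCat.{u} R → Prop}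

lemma theta_inj (h : GG.CousinResolves R F M P) (n : ℕ) :
    Function.Injective (GG.cousinTheta R F M n) := by
  cases n with
  | zero => exact h.2.1
  | succ n =>
    rw [injective_iff_map_eq_zero]
    intro x hx
    obtain ⟨y, rfl⟩ := Submodule.mkQ_surjective _ x
    have : y ∈ LinearMap.ker (GG.cousinD R F M n) := hx
    rw [h.2.2.1] at this
    exact (Submodule.Quotient.mk_eq_zero _).2 this

lemma cousin_ses (h : GG.CousinResolves R F M P) (n : ℕ) :
    ∃ (f : GG.cousinK R F M n →ₗ[R] GG.cousinC R F M n)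
      (g : GG.cousinC R F M n →ₗ[R] GG.cousinK R F M (n+1)) (hex : Function.Exact f g),
      (mkS f g hex).ShortExact := by
  have hc : ∀ x, GG.cousinTheta R F M n x ∈ GG.finSupp R (F n \ F (n + 1)) (GG.cousinK R F M n) :=
    fun x => h.1 n ⟨x, rfl⟩
  refine ⟨(GG.cousinTheta R F M n).codRestrict _ hc, Submodule.mkQ _, ?_, ?_⟩
  · intro y
    refine (Submodule.Quotient.mk_eq_zero _).trans ?_
    constructor
    · rintro ⟨x, hx⟩
      exact ⟨x, Subtype.ext hx⟩
    · rintro ⟨x, rfl⟩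
      exact ⟨x, rfl⟩
  · refine mkS_exact _ _ _ ?_ (Submodule.mkQ_surjective _)
    intro x y hxy
    exact theta_inj h n (congrArg Subtype.val hxy)

end Cousin

variable {M : ModuleCat.{u} R}

lemma htM_le (p : PrimeSpectrum R) (hp : p ∈ Module.support R M) :
    ((GG.htM R M p : ℕ∞) : WithBot ℕ∞) ≤ Module.supportDim R M := by
  have : GG.htM R M p = Order.height (⟨p, hp⟩ : ↥(Module.support R M)) := by
    simp [GG.htM, hp]
  rw [this]
  exact Order.height_le_krullDim _

lemma ext_up (h : GG.CousinResolves R (GG.heightFiltration R M) M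
      (fun N => GG.IsGorensteinInjective R N)) (t : ℕ) (ht : Module.supportDim R M ≤ t)
    {N : ModuleCat.{u} R} (hN : QF N) (i n : ℕ) (hi : t < i + n) :
    Subsingleton (Ext N (GG.cousinK R (GG.heightFiltration R M) M n) i) := by
  induction i generalizing n with
  | zero =>
    apply sub_right
    have : IsEmpty ↥(GG.heightFiltration R M n \ GG.heightFiltration R M (n+1)) := by
      refine ⟨fun p => ?_⟩
      obtain ⟨p, ⟨hp, hp1⟩, -⟩ := p
      have h1 := (htM_le p hp).trans ht
      have h2 : GG.htM R M p ≤ (t : ℕ∞) := by exact_mod_cast h1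
      have h3 := hp1.trans h2
      have h4 : n ≤ t := by exact_mod_cast h3
      lia
    exact (theta_inj h n).subsingleton
  | succ i ih =>
    obtain ⟨f, g, hex, hS⟩ := cousin_ses h n
    exact cov1 hS N (ih (n+1) (by lia)) (hN.gi _ (h.2.2.2 n) i)

lemma ext_low [IsLocalRing R] (h : GG.CousinResolves R (GG.heightFiltration R M) M
      (fun N => GG.IsGorensteinInjective R N)) (t : ℕ)
    (ht : ∀ p ∈ Module.support R M, GG.htM R M p < t → p.asIdeal ≠ IsLocalRing.maximalIdeal R)
    {N : ModuleCat.{u} R} (hN : QF N)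
    (hNm : ∀ a ∈ IsLocalRing.maximalIdeal R, ∃ k : ℕ, ∀ x : N, a ^ k • x = 0)
    (i n : ℕ) (hi : i + n < t) :
    Subsingleton (Ext N (GG.cousinK R (GG.heightFiltration R M) M n) i) := by
  induction i generalizing n with
  | zero =>
    have key : ∀ f : N →ₗ[R] GG.cousinC R (GG.heightFiltration R M) M n, f = 0 := by
      intro f
      ext x ⟨p, ⟨hp, hp1⟩, hp2⟩
      have h1 : GG.htM R M p < t := by
        have : GG.htM R M p < (n + 1 : ℕ) := by
          by_contra hc
          exact hp2 ⟨hp, not_lt.1 hc⟩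
        refine this.trans_le ?_
        exact_mod_cast (by lia : n + 1 ≤ t)
      have h2 := ht p hp h1
      obtain ⟨a, ha, hap⟩ : ∃ a ∈ IsLocalRing.maximalIdeal R, a ∉ p.asIdeal := by
        by_contra hc
        push Not at hc
        exact h2 (le_antisymm (IsLocalRing.le_maximalIdeal p.2.ne_top) hc)
      obtain ⟨k, hk⟩ := hNm a ha
      have hak : a ^ k ∈ p.asIdeal.primeCompl := fun hc => hap (p.2.mem_of_pow_mem _ hc)
      refine IsLocalizedModule.smul_injective (LocalizedModule.mkLinearMap p.asIdeal.primeCompl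
        (GG.cousinK R (GG.heightFiltration R M) M n)) ⟨a ^ k, hak⟩ ?_
      have h3 := hk x
      have h4 : a ^ k • f x = 0 := by rw [← map_smul, h3, map_zero]
      have h5 := congrFun (congrArg Subtype.val h4) ⟨p, ⟨hp, hp1⟩, hp2⟩
      refine Eq.trans (show _ = _ from h5) ?_
      exact (smul_zero _).symm
    obtain ⟨f, g, hex, hS⟩ := cousin_ses h n
    have hf : Function.Injective f := (ModuleCat.mono_iff_injective _).1 hS.mono_f
    have : Subsingleton (N ⟶ GG.cousinK R (GG.heightFiltration R M) M n) := by
      refine subsingleton_of_forall_eq 0 fun a => ?_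
      ext x
      apply hf
      exact (LinearMap.congr_fun (key (f ∘ₗ a.hom)) x).trans (map_zero f).symm
    exact Ext.linearEquiv₀ (R := R).toEquiv.subsingleton
  | succ i ih =>
    obtain ⟨f, g, hex, hS⟩ := cousin_ses h n
    exact cov1 hS N (ih (n+1) (by lia)) (hN.gi _ (h.2.2.2 n) i)

lemma ht_max [IsLocalRing R] [IsNoetherianRing R] [Nontrivial M] [Module.Finite R M] (t : ℕ)
    (h : Module.supportDim R M = t) :
    ∀ p ∈ Module.support R M, GG.htM R M p < t → p.asIdeal ≠ IsLocalRing.maximalIdeal R := by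
  intro p hp hlt hpm
  let i : OrderTop ↥(Module.support R M) :=
    { top := ⟨p, hp⟩
      le_top := fun q => by
        show q.1.asIdeal ≤ p.asIdeal
        rw [hpm]
        exact IsLocalRing.le_maximalIdeal q.1.2.ne_top }
  have h1 : GG.htM R M p = Order.height (⟨p, hp⟩ : ↥(Module.support R M)) := by
    simp [GG.htM, hp]
  have h2 : Order.krullDim ↥(Module.support R M) = Order.height (⊤ : ↥(Module.support R M)) :=
    (Order.height_top_eq_krullDim).symm
  have h3 : ((t : ℕ∞) : WithBot ℕ∞) = Order.height (⟨p, hp⟩ : ↥(Module.support R M)) :=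
    h.symm.trans h2
  rw [← h1] at h3
  exact hlt.ne (WithBot.coe_injective h3).symm
end GGP

namespace GGP
open CategoryTheory Opposite Abelian IsLocalRing
open scoped Pointwise

variable {R : Type u} [CommRing R]

lemma ext_smul_zero {N M : ModuleCat.{u} R} {a : R} (h : ∀ x : N, a • x = 0) (i : ℕ)
    (e : Ext N M i) : a • e = 0 := by
  have h0 : a • 𝟙 N = 0 := by
    apply ModuleCat.hom_ext
    apply LinearMap.ext
    intro x
    exact h x
  rw [← e.mk₀_id_comp, ← Ext.smul_comp, ← Ext.mk₀_smul, h0, Ext.mk₀_zero, Ext.zero_comp]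

section mul
variable {N : ModuleCat.{u} R} {x : R}

lemma mul_eq (M : ModuleCat.{u} R) (_ : IsSMulRegular N x) {i : ℕ} (e : Ext N M i) :
    (Ext.mk₀ (N.smulShortComplex x).f).comp e (zero_add _) = x • e := by
  have h1 : (Ext.mk₀ (x • 𝟙 N)).comp e (zero_add i) = x • e := by
    rw [Ext.mk₀_smul, Ext.smul_comp, Ext.mk₀_id_comp]
  exact h1

lemma mul_reg (M : ModuleCat.{u} R) (reg : IsSMulRegular N x) {i : ℕ} (h : Subsingleton (Ext (ModuleCat.of R (QuotSMulTop x N)) M i)) :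
    IsSMulRegular (Ext N M i) x := by
  rw [isSMulRegular_iff_right_eq_zero_of_smul]
  intro e he
  obtain ⟨b, hb⟩ := Ext.contravariant_sequence_exact₂ reg.smulShortComplex_shortExact M e
    ((mul_eq M reg e).trans he)
  have : b = 0 := h.elim _ _
  rw [← hb, this]
  exact Ext.comp_zero _ _ _ _ _

lemma mul_surj (M : ModuleCat.{u} R) (reg : IsSMulRegular N x) {i : ℕ} (e : Ext N M i)
    (he : reg.smulShortComplex_shortExact.extClass.comp e (add_comm 1 i) = 0) :
    ∃ b, x • b = e := by
  obtain ⟨b, hb⟩ := Ext.contravariant_sequence_exact₁ reg.smulShortComplex_shortExact M e _ he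
  exact ⟨b, (mul_eq M reg b).symm.trans hb⟩

lemma mul_vanish (M : ModuleCat.{u} R) (reg : IsSMulRegular N x) [IsLocalRing R] [IsNoetherianRing R] [Module.Finite R N] [Module.Finite R M]
    (hx : x ∈ maximalIdeal R) {i : ℕ}
    (h : Subsingleton (Ext (ModuleCat.of R (QuotSMulTop x N)) M (i+1))) :
    Subsingleton (Ext N M i) := by
  by_contra hc
  rw [not_subsingleton_iff_nontrivial] at hc
  have := nontrivial_quotSMulTop_of_mem_maximalIdeal (Ext N M i) hx
  rw [Submodule.Quotient.nontrivial_iff] at this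
  apply this
  rw [eq_top_iff]
  intro e _
  obtain ⟨b, hb⟩ := mul_surj M reg e (h.elim _ _)
  rw [← hb]
  exact Submodule.smul_mem_pointwise_smul _ _ _ trivial

lemma mul_quot (M : ModuleCat.{u} R) (reg : IsSMulRegular N x) {i : ℕ} (h : Subsingleton (Ext N M (i+1))) :
    Nonempty (QuotSMulTop x (Ext N M i) ≃ₗ[R] Ext (ModuleCat.of R (QuotSMulTop x N)) M (i+1)) := by
  let δ : Ext N M i →ₗ[R] Ext (ModuleCat.of R (QuotSMulTop x N)) M (i+1) :=
    reg.smulShortComplex_shortExact.extClass.precompOfLinear R M (add_comm 1 i)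
  have hs : Function.Surjective δ := by
    intro a
    obtain ⟨b, hb⟩ := Ext.contravariant_sequence_exact₃ reg.smulShortComplex_shortExact M a
      (h.elim _ _) (add_comm 1 i)
    exact ⟨b, hb⟩
  have hk : LinearMap.ker δ = x • ⊤ := by
    ext e
    constructor
    · intro he
      obtain ⟨b, hb⟩ := mul_surj M reg e he
      rw [← hb]
      exact Submodule.smul_mem_pointwise_smul _ _ _ trivial
    · intro he
      obtain ⟨b, -, rfl⟩ := (Submodule.mem_smul_pointwise_iff_exists _ _ _).1 he
      rw [LinearMap.mem_ker, map_smul]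
      refine ext_smul_zero (fun y => ?_) _ _
      obtain ⟨y, rfl⟩ := Submodule.mkQ_surjective _ y
      rw [← map_smul]
      exact (Submodule.Quotient.mk_eq_zero _).2 (Submodule.smul_mem_pointwise_smul _ _ _ trivial)
  exact ⟨(Submodule.quotEquivOfEq _ _ hk.symm).trans (δ.quotKerEquivOfSurjective hs)⟩

lemma QF.mul (reg : IsSMulRegular N x) (h : QF N) : QF (ModuleCat.of R (QuotSMulTop x N)) :=
  QF.right reg.smulShortComplex_shortExact h h

end mul

section loc
variable [IsLocalRing R]

/-- Each element of the maximal ideal acts nilpotently. -/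
def Km (N : Type u) [AddCommGroup N] [Module R N] : Prop :=
  ∀ a ∈ maximalIdeal R, ∃ k : ℕ, ∀ x : N, a ^ k • x = 0

lemma Km.inj {N N' : Type u} [AddCommGroup N] [Module R N] [AddCommGroup N'] [Module R N']
    (f : N →ₗ[R] N') (hf : Function.Injective f) (h : Km (R := R) N') : Km (R := R) N := by
  intro a ha
  obtain ⟨k, hk⟩ := h a ha
  exact ⟨k, fun x => hf (by rw [map_smul, hk, map_zero])⟩

lemma Km.surj {N N' : Type u} [AddCommGroup N] [Module R N] [AddCommGroup N'] [Module R N']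
    (f : N' →ₗ[R] N) (hf : Function.Surjective f) (h : Km (R := R) N') : Km (R := R) N := by
  intro a ha
  obtain ⟨k, hk⟩ := h a ha
  refine ⟨k, fun x => ?_⟩
  obtain ⟨x, rfl⟩ := hf x
  rw [← map_smul, hk, map_zero]

lemma Km.ext {N M : ModuleCat.{u} R} (h : Km (R := R) N) (i : ℕ) : Km (R := R) (Ext N M i) := by
  intro a ha
  obtain ⟨k, hk⟩ := h a ha
  exact ⟨k, fun e => ext_smul_zero hk i e⟩

lemma Km.of_dim {N : Type u} [AddCommGroup N] [Module R N] [Module.Finite R N]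
    (h : Module.supportDim R N = 0) : Km (R := R) N := by
  intro a ha
  have h1 := support_of_supportDim_eq_zero R N h
  rw [Module.support_eq_zeroLocus] at h1
  have h2 : a ∈ (Module.annihilator R N).radical := by
    rw [← PrimeSpectrum.vanishingIdeal_zeroLocus_eq_radical, h1,
      PrimeSpectrum.vanishingIdeal_zeroLocus_eq_radical]
    exact Ideal.le_radical ha
  obtain ⟨k, hk⟩ := h2
  exact ⟨k, Module.mem_annihilator.1 hk⟩

lemma Km.dim {N : Type u} [AddCommGroup N] [Module R N] [Module.Finite R N] [Nontrivial N]
    (h : Km (R := R) N) : Module.supportDim R N = 0 := by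
  have h1 : ∀ p ∈ Module.support R N, p.asIdeal = maximalIdeal R := by
    intro p hp
    rw [Module.support_eq_zeroLocus] at hp
    refine le_antisymm (le_maximalIdeal p.2.ne_top) fun a ha => ?_
    obtain ⟨k, hk⟩ := h a ha
    exact p.2.mem_of_pow_mem k (hp (Module.mem_annihilator.2 hk))
  have : Subsingleton (Module.support R N) :=
    ⟨fun p q => Subtype.ext (PrimeSpectrum.ext ((h1 p.1 p.2).trans (h1 q.1 q.2).symm))⟩
  have : Nonempty (Module.support R N) :=
    (Module.nonempty_support_iff.2 ‹_›).to_subtype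
  exact Order.krullDim_eq_zero

lemma devissage [IsNoetherianRing R] (M : ModuleCat.{u} R) (i : ℕ)
    (hk : Subsingleton (Ext (ModuleCat.of R (R ⧸ maximalIdeal R)) M i))
    (N : Type u) [AddCommGroup N] [Module R N] [Module.Finite R N] (h : Km (R := R) N) :
    Subsingleton (Ext (ModuleCat.of R N) M i) := by
  revert h
  refine IsNoetherianRing.induction_on_isQuotientEquivQuotientPrime R (M := N) inferInstance
    (motive := fun N _ _ _ => Km (R := R) N → Subsingleton (Ext (ModuleCat.of R N) M i)) ?_ ?_ ?_
  · intro N _ _ _ _ _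
    exact sub_left (by assumption) _
  · intro N _ _ _ p e h
    have h' := h.surj e.toLinearMap e.surjective
    have hp : p.1 = maximalIdeal R := by
      refine le_antisymm (le_maximalIdeal p.2.ne_top) fun a ha => ?_
      obtain ⟨k, hk⟩ := h' a ha
      have h1 := hk (Submodule.mkQ _ 1)
      rw [← map_smul] at h1
      have h2 := (Submodule.Quotient.mk_eq_zero _).1 h1
      rw [smul_eq_mul, mul_one] at h2
      exact p.2.mem_of_pow_mem k h2
    exact sub_of_iso' (e.trans (Submodule.quotEquivOfEq _ _ hp)).symm.toModuleIso hk
  · intro N₁ _ _ _ N₂ _ _ _ N₃ _ _ _ f g hf hg hex h1 h3 h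
    exact contra2 (mkS_exact f g hex hf hg) M (h1 (h.inj f hf)) (h3 (h.surj g hg))

lemma devissage_ne [IsNoetherianRing R] (M : ModuleCat.{u} R) (i : ℕ)
    (hk : Nontrivial (Ext (ModuleCat.of R (R ⧸ maximalIdeal R)) M i))
    (hlow : ∀ j < i, Subsingleton (Ext (ModuleCat.of R (R ⧸ maximalIdeal R)) M j))
    (N : Type u) [AddCommGroup N] [Module R N] [Module.Finite R N] [Nontrivial N]
    (h : Km (R := R) N) : Nontrivial (Ext (ModuleCat.of R N) M i) := by
  obtain ⟨K, hK, -⟩ := (eq_top_or_exists_le_coatom (⊥ : Submodule R N)).resolve_left bot_ne_top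
  have hs : IsSimpleModule R (N ⧸ K) := isSimpleModule_iff_isCoatom.2 hK
  obtain ⟨I, hI, ⟨e⟩⟩ := isSimpleModule_iff_quot_maximal.1 hs
  obtain rfl := eq_maximalIdeal hI
  have hex : Function.Exact K.subtype K.mkQ := LinearMap.exact_subtype_mkQ K
  have hS := mkS_exact K.subtype K.mkQ hex K.subtype_injective K.mkQ_surjective
  by_contra hc
  rw [not_nontrivial_iff_subsingleton] at hc
  have h3 : Subsingleton (Ext (ModuleCat.of R (N ⧸ K)) M i) := by
    cases i with
    | zero =>
      refine subsingleton_of_forall_eq 0 fun a => ?_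
      obtain ⟨a, rfl⟩ := (Ext.mk₀_bijective _ _).2 a
      have h0 : (mkS K.subtype K.mkQ hex).g ≫ a = 0 :=
        (Ext.mk₀_bijective (ModuleCat.of R N) M).1 (hc.elim _ _)
      have := hS.epi_g
      have h1 : a = 0 := (cancel_epi (mkS K.subtype K.mkQ hex).g).1 (by rw [h0, Limits.comp_zero])
      rw [h1, Ext.mk₀_zero]
    | succ i => exact contra3 hS M (devissage M i (hlow i (by lia)) K (h.inj _ K.subtype_injective)) hc
  exact not_subsingleton _ (sub_of_iso' e.toModuleIso h3)
end loc

end GGP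

namespace GGP
open CategoryTheory Opposite Abelian IsLocalRing

variable {R : Type u} [CommRing R]

lemma wb (a : WithBot ℕ∞) (n k : ℕ) (h : a + (n : WithBot ℕ∞) = (k : WithBot ℕ∞)) :
    ∃ m : ℕ, a = m ∧ m + n = k := by
  induction a with
  | bot => simp at h
  | coe a =>
    have h1 : a + (n : ℕ∞) = (k : ℕ∞) := by exact_mod_cast h
    induction a with
    | top => simp at h1
    | coe a => exact ⟨a, rfl, by exact_mod_cast h1⟩

lemma wb_lt (a : WithBot ℕ∞) (ha : a ≠ ⊥) (k : ℕ) (h : a < (k : WithBot ℕ∞)) :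
    ∃ m : ℕ, a = m ∧ m < k := by
  induction a with
  | bot => exact absurd rfl ha
  | coe a =>
    have h1 : a < (k : ℕ∞) := by exact_mod_cast h
    induction a with
    | top => simp at h1
    | coe a => exact ⟨a, rfl, by exact_mod_cast h1⟩

section
variable [IsLocalRing R] [IsNoetherianRing R]

lemma depth_att (N : Type u) [AddCommGroup N] [Module R N] [Nontrivial N] (s : ℕ)
    (h : GG.mdepth R N = s) : ∃ rs : List R, rs.length = s ∧
      (∀ r ∈ rs, r ∈ maximalIdeal R) ∧ RingTheory.Sequence.IsRegular N rs := by
  have h1 : GG.mdepth R N ∈ {c : ℕ∞ | ∃ rs : List R, c = rs.length ∧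
    (∀ r ∈ rs, r ∈ IsLocalRing.maximalIdeal R) ∧ RingTheory.Sequence.IsRegular N rs} := by
    have hne : Nonempty {c : ℕ∞ | ∃ rs : List R, c = rs.length ∧
        (∀ r ∈ rs, r ∈ IsLocalRing.maximalIdeal R) ∧ RingTheory.Sequence.IsRegular N rs} :=
      ⟨0, [], by simp, by simp, RingTheory.Sequence.IsRegular.nil R N⟩
    apply ENat.sSup_mem_of_nonempty_of_lt_top
    · change GG.mdepth R N < ⊤
      rw [h]
      exact ENat.coe_lt_top s
  obtain ⟨rs, h2, h3, h4⟩ := h1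
  refine ⟨rs, ?_, h3, h4⟩
  rw [h] at h2
  exact_mod_cast h2.symm

lemma depth_eq (E : Type u) [AddCommGroup E] [Module R E] [Module.Finite R E] (rs : List R)
    (hm : ∀ r ∈ rs, r ∈ maximalIdeal R) (hr : RingTheory.Sequence.IsRegular E rs)
    (hd : Module.supportDim R E = (rs.length : ℕ)) : GG.mdepth R E = rs.length := by
  apply le_antisymm
  · apply sSup_le
    rintro c ⟨ss, rfl, -, hs⟩
    have h1 := Module.supportDim_add_length_eq_supportDim_of_isRegular ss hs
    rw [hd] at h1
    obtain ⟨m, -, hm⟩ := wb _ _ _ h1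
    exact_mod_cast (by lia : ss.length ≤ rs.length)
  · exact le_sSup ⟨rs, rfl, hm, hr⟩

variable {M : ModuleCat.{u} R} [Module.Finite R M]

lemma chain (rs : List R) (hm : ∀ r ∈ rs, r ∈ maximalIdeal R) (N : ModuleCat.{u} R)
    [Module.Finite R N] (hN : QF N) (hr : RingTheory.Sequence.IsRegular N rs) (i : ℕ)
    (hi : Nontrivial (Ext N M i)) :
    ∃ N' : ModuleCat.{u} R, Module.Finite R N' ∧ QF N' ∧
      Module.supportDim R N' + (rs.length : ℕ) = Module.supportDim R N ∧
      Nontrivial (Ext N' M (i + rs.length)) := by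
  induction rs generalizing N i with
  | nil => exact ⟨N, inferInstance, hN, by simp, hi⟩
  | cons x rs ih =>
    have hx : x ∈ maximalIdeal R := hm x (by simp)
    obtain ⟨h1, h2⟩ := (RingTheory.Sequence.isRegular_cons_iff N _ _).1 hr
    have h3 : Nontrivial (Ext (ModuleCat.of R (QuotSMulTop x N)) M (i+1)) := by
      by_contra hc
      rw [not_nontrivial_iff_subsingleton] at hc
      exact not_subsingleton _ (mul_vanish M h1 hx hc)
    obtain ⟨N', g1, g2, g3, g4⟩ := ih (fun r hr => hm r (by simp [hr]))
      (ModuleCat.of R (QuotSMulTop x N)) (QF.mul h1 hN) h2 (i+1) h3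
    refine ⟨N', g1, g2, ?_, ?_⟩
    · rw [← Module.supportDim_quotSMulTop_succ_eq_supportDim h1 hx]
      have : Module.supportDim R (QuotSMulTop x N) =
        Module.supportDim R N' + (rs.length : ℕ) := g3.symm
      rw [this]
      simp [add_assoc]
    · have : i + (x :: rs).length = i + 1 + rs.length := by simp; lia
      rwa [this]

lemma top_ne (hM : Nontrivial M) (h : GG.CousinResolves R (GG.heightFiltration R M) M
      (fun N => GG.IsGorensteinInjective R N)) (d : ℕ) (hd : ringKrullDim R = d)
    (hCM : GG.IsCMLocalRing R) : Module.supportDim R M = d ∧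
    ∃ N' : ModuleCat.{u} R, Module.Finite R N' ∧ Km (R := R) N' ∧ Nontrivial (Ext N' M d) := by
  have h1 : GG.mdepth R R = d := by
    have : ((GG.mdepth R R : ℕ∞) : WithBot ℕ∞) = ((d : ℕ∞) : WithBot ℕ∞) := hCM.trans hd
    exact_mod_cast this
  obtain ⟨rs, hl, hm, hr⟩ := depth_att R d h1
  have h0 : Nontrivial (Ext (ModuleCat.of R R) M 0) := by
    by_contra hc
    rw [not_nontrivial_iff_subsingleton] at hc
    obtain ⟨x, hx⟩ := exists_ne (0 : M)
    apply hx
    have h2 : ModuleCat.ofHom (LinearMap.toSpanSingleton R M x) = 0 :=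
      (Ext.mk₀_bijective (ModuleCat.of R R) M).1 (hc.elim _ _)
    have h3 := LinearMap.congr_fun (congrArg ModuleCat.Hom.hom h2) (1 : R)
    simpa using h3
  have hP : Module.Projective R (ModuleCat.of R R) :=
    inferInstanceAs (Module.Projective R R)
  have hF : Module.Finite R (ModuleCat.of R R) :=
    inferInstanceAs (Module.Finite R R)
  obtain ⟨N', g1, g2, g3, g4⟩ := chain (M := M) rs hm (ModuleCat.of R R) (QF.of_proj hP) hr 0 h0
  rw [hl, zero_add] at g4
  have g5 : Module.supportDim R N' + (d : WithBot ℕ∞) = (d : ℕ) := by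
    rw [← hl, g3, hl, ← hd]
    exact Module.supportDim_self_eq_ringKrullDim R
  obtain ⟨m, hm1, hm2⟩ := wb _ _ _ g5
  obtain rfl : m = 0 := by lia
  refine ⟨?_, N', g1, Km.of_dim (by rw [hm1]; rfl), g4⟩
  apply le_antisymm
  · rw [← hd]; exact Module.supportDim_le_ringKrullDim R M
  · by_contra hc
    rw [not_le] at hc
    obtain ⟨t, ht1, ht2⟩ := wb_lt _ (Module.supportDim_ne_bot_of_nontrivial R M) d hc
    exact (not_subsingleton_iff_nontrivial.2 g4) (ext_up h t ht1.le g2 d 0 (by lia))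

variable (d : ℕ)

lemma base (hM : Nontrivial M) (h : GG.CousinResolves R (GG.heightFiltration R M) M
      (fun N => GG.IsGorensteinInjective R N)) (hd : Module.supportDim R M = d)
    (hex : ∃ N' : ModuleCat.{u} R, Module.Finite R N' ∧ Km (R := R) N' ∧ Nontrivial (Ext N' M d))
    (N : ModuleCat.{u} R) [Module.Finite R N] [Nontrivial N] (hN : QF N) (hK : Km (R := R) N) :
    (∀ i, i ≠ d → Subsingleton (Ext N M i)) ∧ Nontrivial (Ext N M d) := by
  have hv : ∀ i, i ≠ d → Subsingleton (Ext N M i) := by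
    intro i hi
    rcases lt_or_gt_of_ne hi with hi | hi
    · exact ext_low h d (ht_max d hd) hN hK i 0 hi
    · exact ext_up h d hd.le hN i 0 hi
  refine ⟨hv, ?_⟩
  classical
  have hex' : ∃ i, Nontrivial (Ext (ModuleCat.of R (R ⧸ maximalIdeal R)) M i) := by
    refine ⟨d, ?_⟩
    obtain ⟨N', g1, g2, g3⟩ := hex
    by_contra hc
    rw [not_nontrivial_iff_subsingleton] at hc
    exact not_subsingleton _ (devissage M d hc N' g2)
  have h1 := devissage_ne M (Nat.find hex') (Nat.find_spec hex')
    (fun j hj => not_nontrivial_iff_subsingleton.1 (Nat.find_min hex' hj)) N hK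
  have h2 : Nat.find hex' = d := by
    by_contra hc
    exact not_subsingleton _ (hv _ hc)
  rw [h2] at h1
  exact h1

lemma main (hM : Nontrivial M) (h : GG.CousinResolves R (GG.heightFiltration R M) M
      (fun N => GG.IsGorensteinInjective R N)) (hd : Module.supportDim R M = d)
    (hex : ∃ N' : ModuleCat.{u} R, Module.Finite R N' ∧ Km (R := R) N' ∧ Nontrivial (Ext N' M d))
    (rs : List R) (hm : ∀ r ∈ rs, r ∈ maximalIdeal R) (hle : rs.length ≤ d)
    (N : ModuleCat.{u} R) [Module.Finite R N] (hN : QF N)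
    (hr : RingTheory.Sequence.IsRegular N rs) (hs : Module.supportDim R N = (rs.length : ℕ)) :
    (∀ i, i + rs.length ≠ d → Subsingleton (Ext N M i)) ∧
    ∃ j, j + rs.length = d ∧ RingTheory.Sequence.IsRegular (Ext N M j) rs ∧
      Module.supportDim R (Ext N M j) = (rs.length : ℕ) := by
  induction rs generalizing N with
  | nil =>
    have hnt : Nontrivial N := by
      rw [← Module.supportDim_ne_bot_iff_nontrivial R, hs]
      exact WithBot.coe_ne_bot
    have hK : Km (R := R) N := Km.of_dim (by rw [hs]; rfl)
    obtain ⟨h1, h2⟩ := base d hM h hd hex N hN hK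
    refine ⟨fun i hi => h1 i (by simpa using hi), d, rfl, RingTheory.Sequence.IsRegular.nil R _, ?_⟩
    rw [(hK.ext d).dim]
    rfl
  | cons x rs ih =>
    have hx : x ∈ maximalIdeal R := hm x (by simp)
    simp only [List.length_cons] at hle hs ⊢
    obtain ⟨h1, h2⟩ := (RingTheory.Sequence.isRegular_cons_iff N _ _).1 hr
    have hq := Module.supportDim_quotSMulTop_succ_eq_supportDim h1 hx
    have hs' : Module.supportDim R (QuotSMulTop x N) = (rs.length : ℕ) := by
      rw [hs] at hq
      obtain ⟨m, hm1, hm2⟩ := wb _ 1 _ (by exact_mod_cast hq)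
      rw [hm1]
      congr 2
      lia
    obtain ⟨g1, j', g2, g3, g4⟩ := ih (fun r hr => hm r (by simp [hr])) (by lia)
      (ModuleCat.of R (QuotSMulTop x N)) (QF.mul h1 hN) h2 hs'
    obtain ⟨j, rfl⟩ : ∃ j, j' = j + 1 := ⟨j' - 1, by lia⟩
    have hv : ∀ i, i + (rs.length + 1) ≠ d → Subsingleton (Ext N M i) := fun i hi =>
      mul_vanish M h1 hx (g1 (i+1) (by lia))
    have hreg := mul_reg M h1 (g1 j (by lia))
    obtain ⟨e⟩ := mul_quot M h1 (hv (j+1) (by lia))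
    refine ⟨hv, j, by lia, ?_, ?_⟩
    · exact (RingTheory.Sequence.isRegular_cons_iff _ _ _).2 ⟨hreg, (e.isRegular_congr rs).2 g3⟩
    · rw [← Module.supportDim_quotSMulTop_succ_eq_supportDim hreg hx,
        Module.supportDim_eq_of_equiv e, g4]
      rfl
end
end GGP

open GG CategoryTheory Opposite in
/-- Ext against a G–Gorenstein module: vanishing outside degree `d - s` and
Cohen–Macaulayness of `Ext^{d-s}(N, M)`. -/
theorem stmt13 (R : Type u) [CommRing R] [IsLocalRing R] [IsNoetherianRing R]
    (hCM : IsCMLocalRing R) (hR : HasDualizingComplex R)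
    (d : ℕ) (hd : ringKrullDim R = d)
    (M : ModuleCat.{u} R) (hM : IsGGorenstein R M)
    (N : ModuleCat.{u} R) (hNf : Module.Finite R N) (hN0 : ∃ x : N, x ≠ 0)
    (hNCM : IsCMModule R N)
    (hN : (∃ n, idLE R N n) ∨ (∃ n, pdLE R N n))
    (s : ℕ) (hs : mdim R N = (s : WithBot ℕ∞)) (hsd : s ≤ d) :
    (∀ i : ℕ, i ≠ d - s →
      Subsingleton (((_root_.Ext R (ModuleCat.{u} R) i).obj (op N)).obj M)) ∧
    IsCMModule R (((_root_.Ext R (ModuleCat.{u} R) (d - s)).obj (op N)).obj M) ∧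
    mdim R (((_root_.Ext R (ModuleCat.{u} R) (d - s)).obj (op N)).obj M)
      = (s : WithBot ℕ∞) := by
  obtain ⟨⟨x, hx⟩, hMf, hC⟩ := hM
  have hMn : Nontrivial M := nontrivial_of_ne _ _ hx
  obtain ⟨y, hy⟩ := hN0
  have hNn : Nontrivial N := nontrivial_of_ne _ _ hy
  have hQ : GGP.QF N := by
    rcases hN with ⟨n, hn⟩ | ⟨n, hn⟩
    · exact GGP.QF.of_id hn
    · exact GGP.QF.of_pd hn
  obtain ⟨hMd, hex⟩ := GGP.top_ne hMn hC d hd hCM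
  have h1 : GG.mdepth R N = s := by
    have : ((GG.mdepth R N : ℕ∞) : WithBot ℕ∞) = ((s : ℕ∞) : WithBot ℕ∞) := hNCM.trans hs
    exact_mod_cast this
  obtain ⟨rs, rfl, hm, hr⟩ := GGP.depth_att N s h1
  obtain ⟨g1, j, g2, g3, g4⟩ := GGP.main d hMn hC hMd hex rs hm hsd N hQ hr hs
  obtain rfl : j = d - rs.length := by lia
  have e := GGP.extEquiv N M (d - rs.length)
  have hf : Module.Finite R (((_root_.Ext R (ModuleCat.{u} R) (d - rs.length)).obj (op N)).obj M) :=
    Module.Finite.equiv e.symm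
  have hr' := (e.isRegular_congr rs).2 g3
  have hd' := (Module.supportDim_eq_of_equiv e).trans g4
  refine ⟨fun i hi => ?_, ?_, hd'⟩
  · have := g1 i (by lia)
    exact (GGP.extEquiv N M i).toEquiv.subsingleton
  · unfold IsCMModule
    rw [GGP.depth_eq _ rs hm hr' hd']
    exact hd'.symm
end
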